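/- arXiv:2103.07848 — 3 statements merged into one kernel-verified Lean document; each statement's English description precedes it below -/
import Mathlib

section
/- Let δ ∈ [0,2) and suppose the boundary Hardy inequality with constant a > 0 holds on Γ_r for some r > 0. Then the weak Hardy inequality holds on Ω with constants b = a and c = (2+3a) r^{δ/2−1}; that is, ‖d_Γ^{δ/2−1}φ‖_2 ≤ a‖d_Γ^{δ/2}|∇φ|‖_2 + (2+3a) r^{δ/2−1}‖φ‖_2 for all φ ∈ C_c^1(Ω). -/
open MeasureTheory Metric Set ENNReal RealInnerProductSpace

noncomputable section

/-- The Euclidean distance from `x` to the boundary `Γ = ∂Ω` of `Ω`. -/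
def distB {d : ℕ} (Ω : Set (EuclideanSpace ℝ (Fin d))) (x : EuclideanSpace ℝ (Fin d)) : ℝ :=
  Metric.infDist x (frontier Ω)

/-- The boundary layer `Γ_r = {x ∈ Ω : d_Γ(x) < r}`. -/
def bdryLayer {d : ℕ} (Ω : Set (EuclideanSpace ℝ (Fin d))) (r : ℝ) :
    Set (EuclideanSpace ℝ (Fin d)) :=
  {x | x ∈ Ω ∧ distB Ω x < r}

/-- `C_c^1` real functions with compact support contained in `U`. -/
def IsCc1 {d : ℕ} (U : Set (EuclideanSpace ℝ (Fin d)))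
    (ψ : EuclideanSpace ℝ (Fin d) → ℝ) : Prop :=
  ContDiff ℝ 1 ψ ∧ HasCompactSupport ψ ∧ tsupport ψ ⊆ U

/-- The `L²` norm with respect to Lebesgue measure. -/
def L2N {d : ℕ} (f : EuclideanSpace ℝ (Fin d) → ℝ) : ℝ≥0∞ :=
  eLpNorm f 2 volume

/-- The weighted norm `‖d_Γ^p ψ‖₂`. -/
def wNorm {d : ℕ} (Ω : Set (EuclideanSpace ℝ (Fin d))) (p : ℝ)
    (ψ : EuclideanSpace ℝ (Fin d) → ℝ) : ℝ≥0∞ :=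
  L2N (fun x => distB Ω x ^ p * ψ x)

/-- The weighted gradient norm `‖d_Γ^p |∇ψ|‖₂`. -/
def wGradNorm {d : ℕ} (Ω : Set (EuclideanSpace ℝ (Fin d))) (p : ℝ)
    (ψ : EuclideanSpace ℝ (Fin d) → ℝ) : ℝ≥0∞ :=
  L2N (fun x => distB Ω x ^ p * ‖fderiv ℝ ψ x‖)

/-- The (boundary) Hardy inequality `‖d_Γ^{δ/2-1}ψ‖₂ ≤ a ‖d_Γ^{δ/2}|∇ψ|‖₂`
with constant `a` for all test functions `ψ ∈ C_c^1(S)`. -/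
def BHardy {d : ℕ} (Ω : Set (EuclideanSpace ℝ (Fin d))) (δ : ℝ)
    (S : Set (EuclideanSpace ℝ (Fin d))) (a : ℝ) : Prop :=
  ∀ ψ, IsCc1 S ψ → wNorm Ω (δ/2 - 1) ψ ≤ ENNReal.ofReal a * wGradNorm Ω (δ/2) ψ

/-- The weak Hardy inequality `‖d_Γ^{δ/2-1}ψ‖₂ ≤ b ‖d_Γ^{δ/2}|∇ψ|‖₂ + c ‖ψ‖₂`
with constants `b, c` for all test functions `ψ ∈ C_c^1(S)`. -/
def WHardy {d : ℕ} (Ω : Set (EuclideanSpace ℝ (Fin d))) (δ : ℝ)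
    (S : Set (EuclideanSpace ℝ (Fin d))) (b c : ℝ) : Prop :=
  ∀ ψ, IsCc1 S ψ →
    wNorm Ω (δ/2 - 1) ψ ≤ ENNReal.ofReal b * wGradNorm Ω (δ/2) ψ + ENNReal.ofReal c * L2N ψ

/-- The optimal Hardy constant for test functions supported in `S`
(the infimum of the `a > 0` for which the Hardy inequality holds on `S`;
`∞` if there is no such constant). -/
def hardyConstS {d : ℕ} (Ω : Set (EuclideanSpace ℝ (Fin d))) (δ : ℝ)
    (S : Set (EuclideanSpace ℝ (Fin d))) : ℝ≥0∞ :=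
  sInf {t | ∃ a : ℝ, 0 < a ∧ t = ENNReal.ofReal a ∧ BHardy Ω δ S a}

/-- The boundary Hardy constant `a_δ(Γ) = inf_{r>0} a_δ(Γ_r)`. -/
def hardyConst {d : ℕ} (Ω : Set (EuclideanSpace ℝ (Fin d))) (δ : ℝ) : ℝ≥0∞ :=
  ⨅ (r : ℝ) (_ : 0 < r), hardyConstS Ω δ (bdryLayer Ω r)

/-- The local boundary Hardy constant `a_δ(Γ ∩ U) = inf_{r>0} a_δ(Γ_r ∩ U)`. -/
def hardyConstOn {d : ℕ} (Ω : Set (EuclideanSpace ℝ (Fin d))) (δ : ℝ)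
    (U : Set (EuclideanSpace ℝ (Fin d))) : ℝ≥0∞ :=
  ⨅ (r : ℝ) (_ : 0 < r), hardyConstS Ω δ (bdryLayer Ω r ∩ U)

/-- The weak Hardy constant `b_δ(Ω)`: the infimum of the `b > 0` for which there
is a `c > 0` such that the weak Hardy inequality holds on `Ω`. -/
def weakConstDomain {d : ℕ} (Ω : Set (EuclideanSpace ℝ (Fin d))) (δ : ℝ) : ℝ≥0∞ :=
  sInf {t | ∃ b c : ℝ, 0 < b ∧ 0 < c ∧ t = ENNReal.ofReal b ∧ WHardy Ω δ Ω b c}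

/-- The weak Hardy constant `b_δ(Γ)`: the infimum of the `b > 0` for which there
are `r > 0` and `c > 0` such that the weak Hardy inequality holds on `Γ_r`. -/
def weakConstBdry {d : ℕ} (Ω : Set (EuclideanSpace ℝ (Fin d))) (δ : ℝ) : ℝ≥0∞ :=
  sInf {t | ∃ b c r : ℝ, 0 < b ∧ 0 < c ∧ 0 < r ∧ t = ENNReal.ofReal b ∧
    WHardy Ω δ (bdryLayer Ω r) b c}

/-- The weak Hardy constant `b_δ(Γ ∩ U)`. -/
def weakConstOn {d : ℕ} (Ω : Set (EuclideanSpace ℝ (Fin d))) (δ : ℝ)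
    (U : Set (EuclideanSpace ℝ (Fin d))) : ℝ≥0∞ :=
  sInf {t | ∃ b c r : ℝ, 0 < b ∧ 0 < c ∧ 0 < r ∧ t = ENNReal.ofReal b ∧
    WHardy Ω δ (bdryLayer Ω r ∩ U) b c}

/-- A domain: a nonempty open connected proper subset of `ℝ^d`. -/
def IsDomainSet {d : ℕ} (Ω : Set (EuclideanSpace ℝ (Fin d))) : Prop :=
  IsOpen Ω ∧ IsConnected Ω ∧ Ω ≠ Set.univ

open scoped Convolution

/-- Mollification of a Lipschitz function: it keeps the Lipschitz constant, and at each point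
satisfies every two-sided bound that the function satisfies on a small ball. -/
lemma LipschitzWith.exists_contDiff_mollification {E : Type*} [NormedAddCommGroup E]
    [InnerProductSpace ℝ E] [FiniteDimensional ℝ E] [MeasurableSpace E] [BorelSpace E]
    {g : E → ℝ} {K : NNReal} (hg : LipschitzWith K g) {ε : ℝ} (hε : 0 < ε) :
    ∃ H : E → ℝ, ContDiff ℝ 1 H ∧ LipschitzWith K H ∧
      ∀ x lo hi, (∀ y ∈ ball x ε, g y ∈ Icc lo hi) → H x ∈ Icc lo hi := by
  let ρ : ContDiffBump (0 : E) := ⟨ε / 2, ε, by positivity, by linarith⟩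
  have hex : ConvolutionExists (ρ.normed volume) g (ContinuousLinearMap.lsmul ℝ ℝ) volume :=
    ρ.hasCompactSupport_normed.convolutionExists_left _ ρ.continuous_normed
      hg.continuous.locallyIntegrable
  refine ⟨ρ.normed volume ⋆[ContinuousLinearMap.lsmul ℝ ℝ, volume] g, ?_, ?_, ?_⟩
  · exact ρ.hasCompactSupport_normed.contDiff_convolution_left _ ρ.contDiff_normed
      hg.continuous.locallyIntegrable
  · refine LipschitzWith.of_dist_le_mul fun x y => ?_
    rw [dist_eq_norm, convolution_def, convolution_def,
      ← integral_sub (hex x).integrable (hex y).integrable]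
    refine (norm_integral_le_of_norm_le
      (g := fun t => ρ.normed volume t * (K * dist x y)) (ρ.integrable_normed.mul_const _)
      (Filter.Eventually.of_forall fun t => ?_)).trans_eq ?_
    · simp only [ContinuousLinearMap.lsmul_apply, smul_eq_mul]
      rw [← mul_sub, norm_mul, Real.norm_of_nonneg (ρ.nonneg_normed t), ← dist_eq_norm]
      refine mul_le_mul_of_nonneg_left ?_ (ρ.nonneg_normed t)
      simpa using hg.dist_le_mul (x - t) (y - t)
    · rw [integral_mul_const, ρ.integral_normed, one_mul]
  · intro x lo hi h
    have h0 := h x (mem_ball_self hε)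
    have hz : ∀ u : ℝ, u ∈ Icc lo hi ↔ dist u ((lo + hi) / 2) ≤ (hi - lo) / 2 := fun u => by
      rw [Real.dist_eq, abs_le]
      constructor
      · rintro ⟨h1, h2⟩; constructor <;> linarith
      · rintro ⟨h1, h2⟩; constructor <;> linarith
    rw [hz]
    refine dist_convolution_le (R := ε) (by linarith [h0.1, h0.2]) ρ.support_normed_eq.subset
      ρ.nonneg_normed ρ.integral_normed hg.continuous.aestronglyMeasurable
      fun y hy => (hz _).1 (h y hy)

/-- A `C¹` cutoff adapted to a `1`-Lipschitz function `ρ`: it vanishes where `ρ ≥ 3r/4`, has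
gradient at most `3/r`, and differs from `1` by at most `2ρ/r`. -/
lemma exists_contDiff_cutoff {E : Type*} [NormedAddCommGroup E]
    [InnerProductSpace ℝ E] [FiniteDimensional ℝ E] [MeasurableSpace E] [BorelSpace E]
    {ρ : E → ℝ} (hρ : LipschitzWith 1 ρ) (hρ0 : ∀ x, 0 ≤ ρ x) {r : ℝ} (hr : 0 < r) :
    ∃ η : E → ℝ, ContDiff ℝ 1 η ∧ (∀ x, η x ∈ Icc (0 : ℝ) 1) ∧ (∀ x, ‖fderiv ℝ η x‖ ≤ 3 / r) ∧
      (∀ x, 1 - η x ≤ 2 * ρ x / r) ∧ ∀ x, 3 * r / 4 < ρ x → η x = 0 := by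
  have hg : LipschitzWith (3 / r).toNNReal (fun x => min 1 (max 0 (3 / r * ρ x - 1))) := by
    refine LipschitzWith.const_min (LipschitzWith.const_max ?_ 0) 1
    refine LipschitzWith.of_dist_le_mul fun x y => ?_
    rw [Real.coe_toNNReal _ (by positivity), dist_sub_right, Real.dist_eq, ← mul_sub, abs_mul,
      abs_of_nonneg (by positivity : 0 ≤ 3 / r), ← Real.dist_eq]
    have := hρ.dist_le_mul x y
    gcongr
    simpa using this
  obtain ⟨H, hH, hHL, hHb⟩ := hg.exists_contDiff_mollification (by positivity : 0 < r / 12)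
  have hball : ∀ x, ∀ y ∈ ball x (r / 12), |ρ y / r - ρ x / r| ≤ 1 / 12 := fun x y hy => by
    have h1 := hρ.dist_le_mul y x
    rw [Real.dist_eq] at h1
    rw [← sub_div, abs_div, abs_of_pos hr, div_le_iff₀ hr]
    have := mem_ball.1 hy
    simp only [NNReal.coe_one, one_mul] at h1
    linarith
  have h01 : ∀ x, H x ∈ Icc (0 : ℝ) 1 := fun x =>
    hHb x 0 1 fun y _ => ⟨le_min zero_le_one (le_max_left _ _), min_le_left _ _⟩
  have hdiv : ∀ y, 3 / r * ρ y = 3 * (ρ y / r) := fun y => by ring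
  refine ⟨fun x => 1 - H x, contDiff_const.sub hH, fun x => ?_, fun x => ?_, fun x => ?_,
    fun x hx => ?_⟩
  · have := h01 x
    exact ⟨by linarith [this.2], by linarith [this.1]⟩
  · rw [fderiv_const_sub, norm_neg]
    simpa [Real.coe_toNNReal _ (by positivity : 0 ≤ 3 / r)] using
      norm_fderiv_le_of_lipschitz ℝ hHL (x₀ := x)
  · simp only [_root_.sub_sub_cancel, mul_div_assoc]
    have hpos : 0 ≤ ρ x / r := div_nonneg (hρ0 x) hr.le
    refine (hHb x 0 (2 * (ρ x / r)) fun y hy =>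
      ⟨le_min zero_le_one (le_max_left _ _), ?_⟩).2
    have hy' := abs_le.1 (hball x y hy)
    rw [hdiv]
    rcases le_total (1 / 2) (ρ x / r) with h | h
    · exact (min_le_left _ _).trans (by linarith)
    · refine (min_le_right _ _).trans (max_le (by positivity) ?_)
      linarith
  · have hx' : 3 / 4 < ρ x / r := by rw [lt_div_iff₀ hr]; linarith
    have := (hHb x 1 1 fun y hy => ?_)
    · linarith [this.1, this.2]
    · have hy' := abs_le.1 (hball x y hy)
      rw [hdiv]
      exact ⟨le_min le_rfl (le_max_of_le_right (by linarith)), min_le_left _ _⟩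

lemma L2N_add_const_mul_le {d : ℕ} {f g h : EuclideanSpace ℝ (Fin d) → ℝ} {c : ℝ} (hc : 0 ≤ c)
    (hg : AEStronglyMeasurable g) (hh : AEStronglyMeasurable h)
    (hfg : ∀ x, |f x| ≤ |g x| + c * |h x|) :
    L2N f ≤ L2N g + ENNReal.ofReal c * L2N h := by
  have h1 : L2N f ≤ eLpNorm ((fun x => ‖g x‖) + c • fun x => ‖h x‖) 2 volume :=
    eLpNorm_mono_real fun x => hfg x
  refine h1.trans ((eLpNorm_add_le hg.norm (hh.norm.const_smul c) (by norm_num)).trans_eq ?_)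
  rw [eLpNorm_const_smul, eLpNorm_norm, eLpNorm_norm, Real.enorm_of_nonneg hc]
  rfl

/-- If `δ ∈ [0,2)` and the boundary Hardy inequality with constant `a > 0`
holds on `Γ_r` for some `r > 0`, then the weak Hardy inequality holds on `Ω` with
constants `b = a` and `c = (2 + 3a) r^{δ/2-1}`. -/
theorem stmt0 {d : ℕ} (hd : 1 ≤ d) (Ω : Set (EuclideanSpace ℝ (Fin d)))
    (hΩ : IsDomainSet Ω) (δ : ℝ) (hδ : δ ∈ Set.Ico (0:ℝ) 2)
    (a r : ℝ) (ha : 0 < a) (hr : 0 < r)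
    (hH : BHardy Ω δ (bdryLayer Ω r) a) :
    WHardy Ω δ Ω a ((2 + 3*a) * r ^ (δ/2 - 1)) := by
  intro φ ⟨hφ, hφc, hφs⟩
  have hd1 : LipschitzWith 1 (distB Ω) := lipschitz_infDist_pt _
  have hd0 : ∀ x, 0 ≤ distB Ω x := fun x => infDist_nonneg
  obtain ⟨η, hη, hη01, hηd, hηw, hηs⟩ := exists_contDiff_cutoff hd1 hd0 hr
  have hη0 : ∀ x, 3 * r / 4 < distB Ω x → fderiv ℝ η x = 0 := fun x hx => by
    have : η =ᶠ[nhds x] fun _ => 0 :=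
      Filter.mem_of_superset ((isOpen_lt continuous_const hd1.continuous).mem_nhds hx) hηs
    rw [this.fderiv_eq, fderiv_fun_const, Pi.zero_apply]
  have hcut : IsCc1 (bdryLayer Ω r) (fun x => η x * φ x) := by
    refine ⟨hη.mul hφ, hφc.mul_left, fun x hx => ⟨hφs (tsupport_mul_subset_right hx), ?_⟩⟩
    have hsub : tsupport η ⊆ {x | distB Ω x ≤ 3 * r / 4} :=
      closure_minimal (fun y hy => not_lt.1 fun h => hy (hηs y h))
        (isClosed_le hd1.continuous continuous_const)
    have : distB Ω x ≤ 3 * r / 4 := hsub (tsupport_mul_subset_left hx)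
    linarith
  have hmeas : ∀ p : ℝ, Measurable fun x => distB Ω x ^ p := fun p =>
    hd1.continuous.measurable.pow_const p
  have hφ' : Continuous fun x => ‖fderiv ℝ φ x‖ := (hφ.continuous_fderiv one_ne_zero).norm
  have hp1 : δ / 2 - 1 < 0 := by linarith [hδ.2]
  have hp0 : 0 ≤ δ / 2 := by linarith [hδ.1]
  set c := r ^ (δ / 2 - 1) with hc
  have hc0 : 0 < c := Real.rpow_pos_of_pos hr _
  have hcr : r ^ (δ / 2) / r = c := by rw [hc, Real.rpow_sub_one hr.ne']
  have hw1 : ∀ x, distB Ω x ^ (δ / 2 - 1) * (1 - η x) ≤ 2 * c := fun x => by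
    rcases (hd0 x).eq_or_lt with h0 | h0
    · rw [← h0, Real.zero_rpow hp1.ne, zero_mul]
      positivity
    rcases le_total r (distB Ω x) with h | h
    · have h1 : distB Ω x ^ (δ / 2 - 1) ≤ c := Real.rpow_le_rpow_of_nonpos hr h hp1.le
      calc distB Ω x ^ (δ / 2 - 1) * (1 - η x) ≤ c * 1 :=
            mul_le_mul h1 (by linarith [(hη01 x).1]) (by linarith [(hη01 x).2]) hc0.le
        _ ≤ 2 * c := by linarith
    · calc distB Ω x ^ (δ / 2 - 1) * (1 - η x)
          ≤ distB Ω x ^ (δ / 2 - 1) * (2 * distB Ω x / r) := by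
            gcongr
            exact hηw x
        _ = 2 * (distB Ω x ^ (δ / 2) / r) := by
            rw [Real.rpow_sub_one h0.ne']
            field_simp
        _ ≤ 2 * (r ^ (δ / 2) / r) := by gcongr
        _ = 2 * c := by rw [hcr]
  have hw2 : ∀ x, distB Ω x ^ (δ / 2) * ‖fderiv ℝ η x‖ ≤ 3 * c := fun x => by
    rcases le_or_gt (distB Ω x) (3 * r / 4) with h | h
    · calc distB Ω x ^ (δ / 2) * ‖fderiv ℝ η x‖ ≤ r ^ (δ / 2) * (3 / r) := by
            gcongr
            · exact hd0 x
            · linarith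
            · exact hηd x
        _ = 3 * c := by rw [← hcr]; ring
    · rw [hη0 x h, norm_zero, mul_zero]
      positivity
  have hsplit : wNorm Ω (δ / 2 - 1) φ ≤
      wNorm Ω (δ / 2 - 1) (fun x => η x * φ x) + ENNReal.ofReal (2 * c) * L2N φ := by
    refine L2N_add_const_mul_le (by positivity)
      ((hmeas _).aestronglyMeasurable.mul hcut.1.continuous.aestronglyMeasurable)
      hφ.continuous.aestronglyMeasurable fun x => ?_
    have hd2 : 0 ≤ distB Ω x ^ (δ / 2 - 1) := Real.rpow_nonneg (hd0 x) _
    rw [abs_mul, abs_mul, abs_mul, abs_of_nonneg hd2, abs_of_nonneg (hη01 x).1]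
    nlinarith [mul_le_mul_of_nonneg_right (hw1 x) (abs_nonneg (φ x))]
  have hgrad : wGradNorm Ω (δ / 2) (fun x => η x * φ x) ≤
      wGradNorm Ω (δ / 2) φ + ENNReal.ofReal (3 * c) * L2N φ := by
    refine L2N_add_const_mul_le (by positivity)
      ((hmeas _).aestronglyMeasurable.mul hφ'.aestronglyMeasurable)
      hφ.continuous.aestronglyMeasurable fun x => ?_
    have hd2 : 0 ≤ distB Ω x ^ (δ / 2) := Real.rpow_nonneg (hd0 x) _
    have hprod : ‖fderiv ℝ (fun x => η x * φ x) x‖ ≤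
        ‖fderiv ℝ φ x‖ + |φ x| * ‖fderiv ℝ η x‖ := by
      rw [fderiv_fun_mul (hη.differentiable one_ne_zero x) (hφ.differentiable one_ne_zero x)]
      refine (norm_add_le _ _).trans ?_
      rw [norm_smul, norm_smul, Real.norm_of_nonneg (hη01 x).1, Real.norm_eq_abs]
      gcongr
      exact mul_le_of_le_one_left (norm_nonneg _) (hη01 x).2
    rw [abs_of_nonneg (mul_nonneg hd2 (norm_nonneg _)),
      abs_of_nonneg (mul_nonneg hd2 (norm_nonneg _))]
    nlinarith [mul_le_mul_of_nonneg_right (hw2 x) (abs_nonneg (φ x)),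
      mul_le_mul_of_nonneg_left hprod hd2]
  calc wNorm Ω (δ / 2 - 1) φ
      ≤ ENNReal.ofReal a * (wGradNorm Ω (δ / 2) φ + ENNReal.ofReal (3 * c) * L2N φ)
        + ENNReal.ofReal (2 * c) * L2N φ :=
        hsplit.trans (add_le_add_left ((hH _ hcut).trans (mul_le_mul_right hgrad _)) _)
    _ = ENNReal.ofReal a * wGradNorm Ω (δ / 2) φ
        + ENNReal.ofReal ((2 + 3 * a) * c) * L2N φ := by
      rw [mul_add, ← mul_assoc, ← ENNReal.ofReal_mul ha.le, add_assoc, ← add_mul,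
        ← ENNReal.ofReal_add (by positivity) (by positivity)]
      ring_nf
end
end

section
/- Let δ ∈ [0,2) and suppose the weak Hardy inequality with constants b, c > 0 holds on Ω. Then for every ε ∈ (0,1) and every r > 0 with c r^{1−δ/2} < ε, the boundary Hardy inequality with constant a = (1−ε)^{−1} b holds on Γ_r. -/
open MeasureTheory Metric Set ENNReal RealInnerProductSpace

noncomputable section

theorem distB_pos {d : ℕ} {Ω : Set (EuclideanSpace ℝ (Fin d))} (hΩ : IsDomainSet Ω)
    {x : EuclideanSpace ℝ (Fin d)} (hx : x ∈ Ω) : 0 < distB Ω x := by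
  obtain ⟨ho, hconn, hne⟩ := hΩ
  have hfr : (frontier Ω).Nonempty := nonempty_frontier_iff.2 ⟨hconn.nonempty, hne⟩
  refine (isClosed_frontier.notMem_iff_infDist_pos hfr).1 fun hxf => ?_
  rw [ho.frontier_eq] at hxf
  exact hxf.2 hx

/-- On the boundary layer of width `r` the `L²` norm is controlled by the norm with the singular
weight `d_Γ^{δ/2-1}`, with constant `r^{1-δ/2}`. -/
theorem L2N_le_mul_wNorm {d : ℕ} {Ω : Set (EuclideanSpace ℝ (Fin d))} (hΩ : IsDomainSet Ω)
    {δ r : ℝ} (hδ : δ ≤ 2) {ψ : EuclideanSpace ℝ (Fin d) → ℝ}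
    (hψ : Function.support ψ ⊆ bdryLayer Ω r) :
    L2N ψ ≤ ENNReal.ofReal (r ^ (1 - δ / 2)) * wNorm Ω (δ / 2 - 1) ψ := by
  refine eLpNorm_le_mul_eLpNorm_of_ae_le_mul (Filter.Eventually.of_forall fun x => ?_) 2
  by_cases hx : ψ x = 0
  · simp [hx]
  obtain ⟨hxΩ, hxr⟩ := hψ hx
  have hpos := distB_pos hΩ hxΩ
  have hle : distB Ω x ^ (1 - δ / 2) ≤ r ^ (1 - δ / 2) :=
    Real.rpow_le_rpow hpos.le hxr.le (by linarith)
  have hone : distB Ω x ^ (1 - δ / 2) * distB Ω x ^ (δ / 2 - 1) = 1 := by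
    rw [← Real.rpow_add hpos]
    simp
  have hw : 0 ≤ distB Ω x ^ (δ / 2 - 1) := Real.rpow_nonneg hpos.le _
  rw [norm_mul, Real.norm_of_nonneg hw, ← mul_assoc]
  refine le_mul_of_one_le_left (norm_nonneg _) ?_
  exact hone.ge.trans (mul_le_mul_of_nonneg_right hle hw)

/-- If `δ ∈ [0,2)` and the weak Hardy inequality with constants `b, c > 0`
holds on `Ω`, then for every `ε ∈ (0,1)` and every `r > 0` with `c r^{1-δ/2} < ε`,
the boundary Hardy inequality with constant `a = (1-ε)⁻¹ b` holds on `Γ_r`. -/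
theorem stmt1 {d : ℕ} (hd : 1 ≤ d) (Ω : Set (EuclideanSpace ℝ (Fin d)))
    (hΩ : IsDomainSet Ω) (δ : ℝ) (hδ : δ ∈ Set.Ico (0:ℝ) 2)
    (b c : ℝ) (hb : 0 < b) (hc : 0 < c)
    (hW : WHardy Ω δ Ω b c)
    (ε : ℝ) (hε : ε ∈ Set.Ioo (0:ℝ) 1)
    (r : ℝ) (hr : 0 < r) (hrc : c * r ^ (1 - δ/2) < ε) :
    BHardy Ω δ (bdryLayer Ω r) ((1 - ε)⁻¹ * b) := by
  intro ψ ⟨hψ, hψc, hψs⟩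
  have h := hW ψ ⟨hψ, hψc, hψs.trans fun x hx => hx.1⟩
  have hL := L2N_le_mul_wNorm hΩ hδ.2.le ((subset_tsupport ψ).trans hψs)
  have hLfin : L2N ψ ≠ ∞ := (hψ.continuous.memLp_of_hasCompactSupport hψc).eLpNorm_ne_top
  have ha : 0 < 1 - ε := sub_pos.2 hε.2
  by_cases hG : wGradNorm Ω (δ / 2) ψ = ∞
  · rw [hG, ENNReal.mul_top (by simpa using by positivity)]
    exact le_top
  have hN : wNorm Ω (δ / 2 - 1) ψ ≠ ∞ := ne_top_of_le_ne_top (by finiteness) h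
  generalize wNorm Ω (δ / 2 - 1) ψ = N at *
  generalize wGradNorm Ω (δ / 2) ψ = G at *
  generalize L2N ψ = L at *
  lift N to NNReal using hN
  lift G to NNReal using hG
  lift L to NNReal using hLfin
  have hrp : 0 ≤ r ^ (1 - δ / 2) := Real.rpow_nonneg hr.le _
  have h' : (N : ℝ) ≤ b * G + c * L := by
    have := ENNReal.toReal_mono (by finiteness) h
    rwa [ENNReal.toReal_add (by finiteness) (by finiteness), ENNReal.toReal_mul,
      ENNReal.toReal_mul, ENNReal.toReal_ofReal hb.le, ENNReal.toReal_ofReal hc.le] at this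
  have hL' : (L : ℝ) ≤ r ^ (1 - δ / 2) * N := by
    have := ENNReal.toReal_mono (by finiteness) hL
    rwa [ENNReal.toReal_mul, ENNReal.toReal_ofReal hrp] at this
  have hcL : c * L ≤ ε * N := calc
    c * L ≤ c * (r ^ (1 - δ / 2) * N) := by gcongr
    _ = c * r ^ (1 - δ / 2) * N := by ring
    _ ≤ ε * N := by gcongr
  have key : (N : ℝ) ≤ (1 - ε)⁻¹ * b * G := by
    rw [mul_assoc, inv_mul_eq_div, le_div_iff₀ ha]
    linarith
  have hofReal := ENNReal.ofReal_le_ofReal key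
  rwa [ENNReal.ofReal_mul (by positivity), ENNReal.ofReal_coe_nnreal,
    ENNReal.ofReal_coe_nnreal] at hofReal
end
end

section
/- Assume Ω is a uniform domain whose boundary Γ is locally uniformly Ahlfors d_H-regular, where d_H is the Hausdorff dimension of Γ. Let δ ≥ 0 satisfy either δ ∈ [0, 2−(d−d_H)) or δ > 2−(d−d_H). Then there is r_0 > 0 such that for each r ∈ (0, r_0) there exists a > 0 for which the boundary Hardy inequality with constant a holds on Γ_r. -/
open MeasureTheory Metric Set ENNReal RealInnerProductSpace

noncomputable section

/-- A uniform domain in the sense of Martio and Sarvas: there is `σ ≥ 1` such that any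
two points `x, y ∈ Ω` are joined by a `1`-Lipschitz curve of length `l ≤ σ |x-y|`
staying in `Ω` and satisfying `d_Γ(γ(t)) ≥ σ⁻¹ min(t, l-t)`. -/
def UniformDomain {d : ℕ} (Ω : Set (EuclideanSpace ℝ (Fin d))) : Prop :=
  ∃ σ : ℝ, 1 ≤ σ ∧ ∀ x ∈ Ω, ∀ y ∈ Ω, ∃ l : ℝ, 0 ≤ l ∧ l ≤ σ * dist x y ∧
    ∃ γ : ℝ → EuclideanSpace ℝ (Fin d), γ 0 = x ∧ γ l = y ∧
      LipschitzOnWith 1 γ (Set.Icc 0 l) ∧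
      ∀ t ∈ Set.Icc 0 l, γ t ∈ Ω ∧ σ⁻¹ * min t (l - t) ≤ distB Ω (γ t)

/-- The boundary `Γ` of `Ω` is locally uniformly Ahlfors `s`-regular: there are a Borel
measure `μ` on `Γ`, `C > 1` and `R > 0` such that, with `A_z = Γ ∩ B̄(z;R)`,
`C⁻¹ r^s ≤ μ(A_z ∩ B̄(x;r)) ≤ C r^s` for all `z ∈ Γ`, `x ∈ A_z` and `r ∈ (0,2R]`. -/
def LocUnifAhlfors {d : ℕ} (Ω : Set (EuclideanSpace ℝ (Fin d))) (s : ℝ) : Prop :=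
  ∃ (μ : Measure (EuclideanSpace ℝ (Fin d))) (C R : ℝ), 1 < C ∧ 0 < R ∧
    μ (frontier Ω)ᶜ = 0 ∧
    ∀ z ∈ frontier Ω, ∀ x ∈ frontier Ω ∩ Metric.closedBall z R,
      ∀ r ∈ Set.Ioc (0:ℝ) (2*R),
        ENNReal.ofReal (C⁻¹ * r ^ s)
            ≤ μ (frontier Ω ∩ Metric.closedBall z R ∩ Metric.closedBall x r) ∧
        μ (frontier Ω ∩ Metric.closedBall z R ∩ Metric.closedBall x r)
            ≤ ENNReal.ofReal (C * r ^ s)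

section Hardy

open Module Filter Topology

theorem enorm_sub_le_lintegral_fderiv {E : Type*} [NormedAddCommGroup E] [NormedSpace ℝ E]
    {ψ : E → ℝ} (hψ : ContDiff ℝ 1 ψ) {c : ℝ → E} {L : NNReal} (hc : LipschitzWith L c)
    {a b : ℝ} (hab : a ≤ b) :
    ‖ψ (c b) - ψ (c a)‖ₑ ≤ L * ∫⁻ t in Icc a b, ‖fderiv ℝ ψ (c t)‖ₑ := by
  have hG : Continuous fun t => ‖fderiv ℝ ψ (c t)‖ :=
    ((hψ.continuous_fderiv one_ne_zero).comp hc.continuous).norm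
  have hψc : Continuous fun t => ψ (c t) := hψ.continuous.comp hc.continuous
  have key : ∀ ε > (0 : ℝ), ‖ψ (c b) - ψ (c a)‖ ≤
      ∫ t in a..b, (L * ‖fderiv ℝ ψ (c t)‖ + ε) := by
    intro ε hε
    have hI : Continuous fun t => L * ‖fderiv ℝ ψ (c t)‖ + ε := by fun_prop
    refine image_norm_le_of_liminf_right_slope_norm_lt_deriv_boundary
      (f := fun t => ψ (c t) - ψ (c a)) (f' := fun t => L * ‖fderiv ℝ ψ (c t)‖)
      (B := fun s => ∫ t in a..s, (L * ‖fderiv ℝ ψ (c t)‖ + ε))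
      (B' := fun t => L * ‖fderiv ℝ ψ (c t)‖ + ε)
      (hψc.sub continuous_const).continuousOn ?_ (by simp) ?_ ?_ ?_ ⟨hab, le_rfl⟩
    · intro x _ r hr
      obtain ⟨η, hη, hηr⟩ : ∃ η > (0 : ℝ), L * (‖fderiv ℝ ψ (c x)‖ + η) < r := by
        have : Tendsto (fun η : ℝ => L * (‖fderiv ℝ ψ (c x)‖ + η)) (𝓝[>] 0)
            (𝓝 (L * (‖fderiv ℝ ψ (c x)‖ + 0))) :=
          (Continuous.tendsto (by fun_prop) _).mono_left nhdsWithin_le_nhds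
        rw [add_zero] at this
        obtain ⟨η, h1, h2⟩ := ((this.eventually_lt_const hr).and self_mem_nhdsWithin).exists
        exact ⟨η, h2, h1⟩
      have hd : HasFDerivAt ψ (fderiv ℝ ψ (c x)) (c x) :=
        (hψ.differentiable one_ne_zero _).hasFDerivAt
      have h1 : ∀ᶠ z in 𝓝[>] x, ‖ψ (c z) - ψ (c x) - fderiv ℝ ψ (c x) (c z - c x)‖
          ≤ η * ‖c z - c x‖ :=
        ((hc.continuous.tendsto x).mono_left nhdsWithin_le_nhds).eventually
          (hd.isLittleO.def hη)
      refine Eventually.frequently ?_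
      filter_upwards [h1, self_mem_nhdsWithin] with z hz hzx
      have hzx' : 0 < z - x := sub_pos.2 hzx
      refine lt_of_le_of_lt ?_ hηr
      rw [slope_def_field, div_le_iff₀ hzx']
      have h2 : ‖c z - c x‖ ≤ L * (z - x) := by
        have := hc.dist_le_mul z x
        rwa [dist_eq_norm, Real.dist_eq, abs_of_pos hzx'] at this
      have h3 : ‖fderiv ℝ ψ (c x) (c z - c x)‖ ≤ ‖fderiv ℝ ψ (c x)‖ * ‖c z - c x‖ :=
        ContinuousLinearMap.le_opNorm _ _
      calc (norm ∘ fun t => ψ (c t) - ψ (c a)) z - (norm ∘ fun t => ψ (c t) - ψ (c a)) x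
          ≤ ‖(ψ (c z) - ψ (c a)) - (ψ (c x) - ψ (c a))‖ := norm_sub_norm_le _ _
        _ = ‖(ψ (c z) - ψ (c x) - fderiv ℝ ψ (c x) (c z - c x))
              + fderiv ℝ ψ (c x) (c z - c x)‖ := by congr 1; ring
        _ ≤ η * ‖c z - c x‖ + ‖fderiv ℝ ψ (c x)‖ * ‖c z - c x‖ :=
            (norm_add_le _ _).trans (add_le_add hz h3)
        _ = (‖fderiv ℝ ψ (c x)‖ + η) * ‖c z - c x‖ := by ring
        _ ≤ (‖fderiv ℝ ψ (c x)‖ + η) * (L * (z - x)) := by gcongr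
        _ = _ := by ring
    · exact (intervalIntegral.continuous_primitive (fun _ _ => hI.intervalIntegrable _ _)
        a).continuousOn
    · intro x _
      exact (intervalIntegral.integral_hasDerivAt_right (hI.intervalIntegrable _ _)
        (hI.stronglyMeasurableAtFilter _ _) hI.continuousAt).hasDerivWithinAt
    · intro x _ _
      linarith
  have key2 : ‖ψ (c b) - ψ (c a)‖ ≤ L * ∫ t in a..b, ‖fderiv ℝ ψ (c t)‖ := by
    refine le_of_forall_pos_le_add fun η hη => ?_
    have h := key (η / (b - a + 1)) (by have := sub_nonneg.2 hab; positivity)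
    rw [intervalIntegral.integral_add ((hG.const_mul _).intervalIntegrable _ _) (by simp),
      intervalIntegral.integral_const_mul, intervalIntegral.integral_const, smul_eq_mul] at h
    refine h.trans (add_le_add le_rfl ?_)
    have := sub_nonneg.2 hab
    rw [mul_div_assoc', div_le_iff₀ (by positivity)]
    nlinarith
  have hInt : IntegrableOn (fun t => ‖fderiv ℝ ψ (c t)‖) (Icc a b) :=
    hG.continuousOn.integrableOn_Icc
  rw [← ofReal_norm]
  refine (ENNReal.ofReal_le_ofReal key2).trans_eq ?_
  rw [ENNReal.ofReal_mul (by positivity), ENNReal.ofReal_coe_nnreal,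
    intervalIntegral.integral_of_le hab, ← integral_Icc_eq_integral_Ioc,
    ofReal_integral_eq_lintegral_ofReal hInt (Eventually.of_forall fun _ => norm_nonneg _)]
  simp_rw [ofReal_norm]

theorem lintegral_mul_sq_le {α : Type*} [MeasurableSpace α] (μ : Measure α) {f g : α → ℝ≥0∞}
    (hf : AEMeasurable f μ) (hg : AEMeasurable g μ) :
    (∫⁻ x, f x * g x ∂μ) ^ 2 ≤ (∫⁻ x, f x ^ 2 ∂μ) * ∫⁻ x, g x ^ 2 ∂μ := by
  have h := ENNReal.lintegral_mul_le_Lp_mul_Lq μ Real.HolderConjugate.two_two hf hg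
  simp only [Pi.mul_apply, ENNReal.rpow_two] at h
  refine (pow_le_pow_left' h 2).trans_eq ?_
  rw [mul_pow, ← ENNReal.rpow_two, ← ENNReal.rpow_two, ← ENNReal.rpow_mul, ← ENNReal.rpow_mul]
  norm_num

theorem enorm_sub_sq_le_lintegral_segment {E : Type*} [NormedAddCommGroup E]
    [NormedSpace ℝ E] {ψ : E → ℝ} (hψ : ContDiff ℝ 1 ψ) (x w : E) :
    ‖ψ x - ψ (x + w)‖ₑ ^ 2
      ≤ ‖w‖ₑ ^ 2 * ∫⁻ t in Icc (0 : ℝ) 1, ‖fderiv ℝ ψ (x + t • w)‖ₑ ^ 2 := by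
  have hc : LipschitzWith ‖w‖₊ fun t : ℝ => x + t • w := by
    refine LipschitzWith.of_dist_le_mul fun s t => ?_
    rw [dist_add_left, dist_eq_norm, ← sub_smul, norm_smul, Real.dist_eq, Real.norm_eq_abs,
      coe_nnnorm, mul_comm]
  have h := enorm_sub_le_lintegral_fderiv hψ hc zero_le_one
  simp only [one_smul, zero_smul, add_zero] at h
  have hg : Continuous fun t : ℝ => ‖fderiv ℝ ψ (x + t • w)‖ₑ :=
    ((hψ.continuous_fderiv one_ne_zero).comp (by fun_prop)).enorm
  have hcs := lintegral_mul_sq_le (volume.restrict (Icc (0 : ℝ) 1)) hg.measurable.aemeasurable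
    (g := fun _ => 1) aemeasurable_const
  simp only [mul_one, one_pow, lintegral_const, Measure.restrict_apply_univ, Real.volume_Icc,
    sub_zero, ENNReal.ofReal_one] at hcs
  rw [← enorm_neg, neg_sub]
  calc ‖ψ (x + w) - ψ x‖ₑ ^ 2 ≤ _ := pow_le_pow_left' h 2
    _ = ‖w‖ₑ ^ 2 * (∫⁻ t in Icc (0 : ℝ) 1, ‖fderiv ℝ ψ (x + t • w)‖ₑ) ^ 2 := by
      rw [mul_pow]; rfl
    _ ≤ _ := by gcongr

theorem lintegral_setLIntegral_swap {α β : Type*} [MeasurableSpace α] [MeasurableSpace β]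
    (μ : Measure α) (ν : Measure β) [SFinite μ] [SFinite ν] {S : α → β → Prop}
    (hS : MeasurableSet {p : α × β | S p.1 p.2}) {f : α → β → ℝ≥0∞}
    (hf : Measurable fun p : α × β => f p.1 p.2) :
    ∫⁻ x, ∫⁻ y in {y | S x y}, f x y ∂ν ∂μ = ∫⁻ y, ∫⁻ x in {x | S x y}, f x y ∂μ ∂ν := by
  have h1 : ∀ x, MeasurableSet {y | S x y} := fun x =>
    (measurable_const.prodMk measurable_id : Measurable fun y : β => (x, y)) hS
  have h2 : ∀ y, MeasurableSet {x | S x y} := fun y =>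
    (measurable_id.prodMk measurable_const : Measurable fun x : α => (x, y)) hS
  simp_rw [← lintegral_indicator (h1 _), ← lintegral_indicator (h2 _)]
  rw [lintegral_lintegral_swap]
  · rfl
  · exact (hf.indicator hS).aemeasurable

theorem rpow_le_of_comparable {K a b : ℝ} (hK : 1 ≤ K) (ha : 0 < a) (hb : 0 < b)
    (hab : a ≤ K * b) (hba : b ≤ K * a) (p : ℝ) : a ^ p ≤ K ^ |p| * b ^ p := by
  have hK0 : 0 < K := by linarith
  rcases le_total 0 p with hp | hp
  · rw [abs_of_nonneg hp, ← Real.mul_rpow hK0.le hb.le]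
    exact Real.rpow_le_rpow ha.le hab hp
  · rw [abs_of_nonpos hp, Real.rpow_neg hK0.le, ← Real.inv_rpow hK0.le,
      ← Real.mul_rpow (by positivity) hb.le]
    refine Real.rpow_le_rpow_of_nonpos (by positivity) ?_ hp
    rw [inv_mul_le_iff₀ hK0]
    exact hba

theorem setLIntegral_infDist_rpow_le {E : Type*} [PseudoMetricSpace E] [MeasurableSpace E]
    [BorelSpace E] (m : Measure E) {Γ : Set E} {ω : E} (hω : ω ∈ Γ) {K : ℝ} (hK : 1 ≤ K) (p : ℝ)
    {P U : ℝ → Prop} (hP : MeasurableSet {b | P b})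
    (hPU : ∀ b c, 0 < b → P b → b ≤ c → c ≤ K * b → U c) :
    ∫⁻ y in {y | dist y ω ≤ K * infDist y Γ ∧ 0 < infDist y Γ ∧ P (infDist y Γ)},
        ENNReal.ofReal (infDist y Γ ^ p) ∂m
      ≤ ENNReal.ofReal (K ^ |p|) * ∫⁻ y in {y | U (dist y ω)}, ENNReal.ofReal (dist y ω ^ p) ∂m := by
  have hD : Measurable fun x : E => infDist x Γ := measurable_infDist
  have hS : MeasurableSet {y | dist y ω ≤ K * infDist y Γ ∧ 0 < infDist y Γ ∧ P (infDist y Γ)} :=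
    (measurableSet_le (by fun_prop) (hD.const_mul K)).inter
      ((measurableSet_lt measurable_const hD).inter (hD hP))
  rw [← lintegral_const_mul' _ _ ENNReal.ofReal_ne_top]
  refine (setLIntegral_mono' hS fun y hy => ?_).trans (lintegral_mono_set fun y hy => ?_)
  · have h1 : infDist y Γ ≤ dist y ω := infDist_le_dist_of_mem hω
    rw [← ENNReal.ofReal_mul (by positivity)]
    refine ENNReal.ofReal_le_ofReal (rpow_le_of_comparable hK hy.2.1 (hy.2.1.trans_le h1) ?_ hy.1 p)
    nlinarith [hy.2.1]
  · exact hPU _ _ hy.2.1 hy.2.2 (infDist_le_dist_of_mem hω) hy.1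

theorem sq_setLIntegral_infDist_le {E : Type*} [NormedAddCommGroup E] [NormedSpace ℝ E]
    [MeasurableSpace E] [BorelSpace E] (m : Measure E) {Γ : Set E} {ω : E} (hω : ω ∈ Γ)
    {K : ℝ} (hK : 1 ≤ K) (θ : ℝ)
    {P U : ℝ → Prop} (hP : MeasurableSet {b | P b})
    (hPU : ∀ b c, 0 < b → P b → b ≤ c → c ≤ K * b → U c) {G : E → ℝ≥0∞} (hG : Measurable G) :
    (∫⁻ y in {y | dist y ω ≤ K * infDist y Γ ∧ 0 < infDist y Γ ∧ P (infDist y Γ)},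
        G y * ENNReal.ofReal (infDist y Γ ^ (1 - (finrank ℝ E : ℝ))) ∂m) ^ 2
      ≤ ENNReal.ofReal (K ^ |θ - finrank ℝ E|) * (∫⁻ y in {y | U (dist y ω)},
          ENNReal.ofReal (dist y ω ^ (θ - (finrank ℝ E : ℝ))) ∂m) *
        ∫⁻ y in {y | dist y ω ≤ K * infDist y Γ ∧ 0 < infDist y Γ ∧ P (infDist y Γ)},
          G y ^ 2 * ENNReal.ofReal (infDist y Γ ^ (2 - (finrank ℝ E : ℝ) - θ)) ∂m := by
  set n : ℝ := ((finrank ℝ E : ℕ) : ℝ) with hn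
  have hD : Measurable fun x : E => infDist x Γ := measurable_infDist
  have hDp (q : ℝ) : Measurable fun x : E => ENNReal.ofReal (infDist x Γ ^ q) :=
    (hD.pow_const q).ennreal_ofReal
  set S := {y | dist y ω ≤ K * infDist y Γ ∧ 0 < infDist y Γ ∧ P (infDist y Γ)} with hSdef
  have hS : MeasurableSet S :=
    (measurableSet_le (by fun_prop) (hD.const_mul K)).inter
      ((measurableSet_lt measurable_const hD).inter (hD hP))
  have hsq (q : ℝ) {y : E} (hy : 0 < infDist y Γ) :
      ENNReal.ofReal (infDist y Γ ^ (q / 2)) ^ 2 = ENNReal.ofReal (infDist y Γ ^ q) := by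
    rw [← ENNReal.ofReal_pow (by positivity), ← Real.rpow_two, ← Real.rpow_mul hy.le,
      div_mul_cancel₀ _ two_ne_zero]
  have hcs := lintegral_mul_sq_le (m.restrict S)
    (f := fun y => ENNReal.ofReal (infDist y Γ ^ ((θ - n) / 2)))
    (g := fun y => G y * ENNReal.ofReal (infDist y Γ ^ ((2 - n - θ) / 2)))
    (hDp _).aemeasurable (hG.mul (hDp _)).aemeasurable
  have e1 : ∫⁻ y in S, G y * ENNReal.ofReal (infDist y Γ ^ (1 - n)) ∂m
      = ∫⁻ y in S, ENNReal.ofReal (infDist y Γ ^ ((θ - n) / 2)) *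
        (G y * ENNReal.ofReal (infDist y Γ ^ ((2 - n - θ) / 2))) ∂m := by
    refine setLIntegral_congr_fun hS fun y hy => ?_
    have : (1 - n) = (θ - n) / 2 + (2 - n - θ) / 2 := by ring
    rw [this, Real.rpow_add hy.2.1, ENNReal.ofReal_mul (Real.rpow_nonneg infDist_nonneg _)]
    ring
  have e2 : ∫⁻ y in S, ENNReal.ofReal (infDist y Γ ^ ((θ - n) / 2)) ^ 2 ∂m
      = ∫⁻ y in S, ENNReal.ofReal (infDist y Γ ^ (θ - n)) ∂m :=
    setLIntegral_congr_fun hS fun y hy => hsq _ hy.2.1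
  have e3 : ∫⁻ y in S, (G y * ENNReal.ofReal (infDist y Γ ^ ((2 - n - θ) / 2))) ^ 2 ∂m
      = ∫⁻ y in S, G y ^ 2 * ENNReal.ofReal (infDist y Γ ^ (2 - n - θ)) ∂m :=
    setLIntegral_congr_fun hS fun y hy => by simp only [mul_pow, hsq _ hy.2.1]
  rw [e2, e3, ← e1] at hcs
  refine hcs.trans ?_
  gcongr
  exact setLIntegral_infDist_rpow_le m hω hK _ hP hPU

theorem LipschitzOnWith.exists_lipschitzWith_eqOn_Icc {X : Type*} [PseudoMetricSpace X] {γ : ℝ → X}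
    {a b : ℝ} (hab : a ≤ b) {L : NNReal} (hγ : LipschitzOnWith L γ (Icc a b)) :
    ∃ c : ℝ → X, LipschitzWith L c ∧ EqOn c γ (Icc a b) := by
  refine ⟨IccExtend hab ((Icc a b).domRestrict γ), ?_, fun t ht => IccExtend_of_mem hab _ ht⟩
  have := (lipschitzOnWith_iff_restrict.1 hγ).comp (LipschitzWith.projIcc hab)
  rwa [mul_one] at this

theorem infDist_le_infDist_add_sub {X : Type*} [PseudoMetricSpace X] {Γ : Set X} {γ : ℝ → X}
    (hγ : LipschitzWith 1 γ) {s t : ℝ}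
    (hst : s ≤ t) : infDist (γ s) Γ ≤ infDist (γ t) Γ + (t - s) ∧
      infDist (γ t) Γ ≤ infDist (γ s) Γ + (t - s) := by
  have h := hγ.dist_le_mul s t
  rw [NNReal.coe_one, one_mul, Real.dist_eq, abs_sub_comm, abs_of_nonneg (sub_nonneg.2 hst)] at h
  exact ⟨infDist_le_infDist_add_dist.trans (by linarith),
    infDist_le_infDist_add_dist.trans (by rw [dist_comm]; linarith)⟩

variable {E : Type*} [NormedAddCommGroup E] [NormedSpace ℝ E] [FiniteDimensional ℝ E]
  [MeasurableSpace E] [BorelSpace E] (m : Measure E) [m.IsAddHaarMeasure]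

theorem lintegral_comp_add_smul {F : E → ℝ≥0∞} (hF : Measurable F) (z : E) {h : ℝ} (hh : 0 < h) :
    ∫⁻ v, F (z + h • v) ∂m = ENNReal.ofReal (h ^ (-(finrank ℝ E : ℝ))) * ∫⁻ y, F y ∂m := by
  have h1 : ∫⁻ v, F (z + h • v) ∂m = ∫⁻ w, F (z + w) ∂(Measure.map (h • ·) m) := by
    rw [lintegral_map (by fun_prop) (by fun_prop)]
  rw [h1, Measure.map_addHaar_smul m hh.ne', lintegral_smul_measure,
    lintegral_add_left_eq_self, smul_eq_mul, abs_of_pos (by positivity), Real.rpow_neg hh.le,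
    Real.rpow_natCast]

theorem setLIntegral_comp_add_smul {F : E → ℝ≥0∞} (hF : Measurable F) (z : E) {h : ℝ}
    (hh : 0 < h) {S : Set E} (hS : MeasurableSet S) :
    ∫⁻ v in {v | z + h • v ∈ S}, F (z + h • v) ∂m
      = ENNReal.ofReal (h ^ (-(finrank ℝ E : ℝ))) * ∫⁻ y in S, F y ∂m := by
  have hS' : MeasurableSet {v : E | z + h • v ∈ S} :=
    (by fun_prop : Measurable fun v : E => z + h • v) hS
  rw [← lintegral_indicator hS, ← lintegral_comp_add_smul m (hF.indicator hS) z hh,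
    ← lintegral_indicator hS']
  rfl

theorem exists_setLIntegral_scale_le {S : Set E} (hS : MeasurableSet S) (p : ℝ)
    (hfin : ∫⁻ x in S, ENNReal.ofReal (‖x‖ ^ p) ∂m ≠ ∞) :
    ∃ C : ℝ≥0∞, C ≠ ∞ ∧ ∀ z : E, ∀ η : ℝ, 0 < η →
      ∫⁻ x in {x | η⁻¹ • (x - z) ∈ S}, ENNReal.ofReal (dist x z ^ p) ∂m
        ≤ C * ENNReal.ofReal (η ^ (p + finrank ℝ E)) := by
  refine ⟨_, hfin, fun z η hη => le_of_eq ?_⟩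
  have h1 := setLIntegral_comp_add_smul m (F := fun x => ENNReal.ofReal (dist x z ^ p))
    (by fun_prop) z hη (S := {x | η⁻¹ • (x - z) ∈ S})
    ((by fun_prop : Measurable fun x : E => η⁻¹ • (x - z)) hS)
  have h2 : {v : E | z + η • v ∈ {x | η⁻¹ • (x - z) ∈ S}} = S := by
    ext v; simp [smul_smul, hη.ne']
  have h3 : ∀ v : E, ENNReal.ofReal (dist (z + η • v) z ^ p)
      = ENNReal.ofReal (η ^ p) * ENNReal.ofReal (‖v‖ ^ p) := by
    intro v
    rw [dist_self_add_left, norm_smul, Real.norm_of_nonneg hη.le,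
      Real.mul_rpow hη.le (norm_nonneg _), ENNReal.ofReal_mul (by positivity)]
  rw [h2] at h1
  simp_rw [h3] at h1
  rw [lintegral_const_mul _ (by fun_prop)] at h1
  have h4 : ENNReal.ofReal (η ^ (finrank ℝ E : ℝ)) * ENNReal.ofReal (η ^ (-(finrank ℝ E : ℝ))) = 1 := by
    rw [← ENNReal.ofReal_mul (by positivity), ← Real.rpow_add hη]; simp
  calc ∫⁻ x in {x | η⁻¹ • (x - z) ∈ S}, ENNReal.ofReal (dist x z ^ p) ∂m
      = (ENNReal.ofReal (η ^ (finrank ℝ E : ℝ)) * ENNReal.ofReal (η ^ (-(finrank ℝ E : ℝ)))) *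
        ∫⁻ x in {x | η⁻¹ • (x - z) ∈ S}, ENNReal.ofReal (dist x z ^ p) ∂m := by
        rw [h4, one_mul]
    _ = _ := by
      rw [mul_assoc, ← h1, Real.rpow_add hη, ENNReal.ofReal_mul (by positivity)]
      ring

theorem exists_setLIntegral_closedBall_rpow_le [Nontrivial E] {p : ℝ}
    (hp : 0 < p + finrank ℝ E) :
    ∃ C : ℝ≥0∞, C ≠ ∞ ∧ ∀ z : E, ∀ η : ℝ, 0 < η →
      ∫⁻ x in closedBall z η, ENNReal.ofReal (dist x z ^ p) ∂m
        ≤ C * ENNReal.ofReal (η ^ (p + finrank ℝ E)) := by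
  have hInt : IntegrableOn (fun x : E => ‖x‖ ^ p) (ball (0 : E) 2) m := by
    refine integrableOn_ball_of_norm_le_rpow (C := 1) (α := -p) finrank_pos (by linarith)
      (Eventually.of_forall fun x => ?_) (measurable_norm.pow_const p).aestronglyMeasurable
    rw [neg_neg, one_mul, Real.norm_of_nonneg (by positivity)]
  have hfin : ∫⁻ x in closedBall (0 : E) 1, ENNReal.ofReal (‖x‖ ^ p) ∂m ≠ ∞ := by
    refine ((hInt.mono_set (closedBall_subset_ball (by norm_num))).lintegral_lt_top).ne
  obtain ⟨C, hC, h⟩ := exists_setLIntegral_scale_le m measurableSet_closedBall p hfin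
  refine ⟨C, hC, fun z η hη => le_of_eq_of_le ?_ (h z η hη)⟩
  congr 2
  ext x
  simp only [mem_closedBall, mem_ofPred_eq, dist_eq_norm, sub_zero, norm_smul, norm_inv,
    Real.norm_of_nonneg hη.le, inv_mul_le_iff₀ hη, mul_one]

theorem exists_setLIntegral_compl_ball_rpow_le {p : ℝ} (hp : p + finrank ℝ E < 0) :
    ∃ C : ℝ≥0∞, C ≠ ∞ ∧ ∀ z : E, ∀ η : ℝ, 0 < η →
      ∫⁻ x in {x | η ≤ dist x z}, ENNReal.ofReal (dist x z ^ p) ∂m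
        ≤ C * ENNReal.ofReal (η ^ (p + finrank ℝ E)) := by
  have hp0 : p < 0 := by have : (0 : ℝ) ≤ finrank ℝ E := by positivity
                         linarith
  have hInt := integrable_one_add_norm (E := E) (μ := m) (r := -p) (by linarith)
  have hS : MeasurableSet {x : E | 1 ≤ ‖x‖} := measurableSet_le (by fun_prop) (by fun_prop)
  have hfin : ∫⁻ x in {x : E | 1 ≤ ‖x‖}, ENNReal.ofReal (‖x‖ ^ p) ∂m ≠ ∞ := by
    refine ne_top_of_le_ne_top (hInt.const_mul ((2 : ℝ) ^ |p|)).lintegral_lt_top.ne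
      ((setLIntegral_mono' hS fun x hx => ?_).trans (setLIntegral_le_lintegral _ _))
    refine ENNReal.ofReal_le_ofReal ?_
    have hx' : 1 ≤ ‖x‖ := hx
    rw [neg_neg]
    exact rpow_le_of_comparable one_le_two (by linarith) (by linarith) (by linarith)
      (by linarith) p
  obtain ⟨C, hC, h⟩ := exists_setLIntegral_scale_le m hS p hfin
  refine ⟨C, hC, fun z η hη => le_of_eq_of_le ?_ (h z η hη)⟩
  congr 2
  ext x
  simp only [mem_ofPred_eq, norm_smul, norm_inv, Real.norm_of_nonneg hη.le, le_inv_mul_iff₀ hη,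
    mul_one, dist_eq_norm]

theorem lintegral_ball_segment_le {Γ : Set E} {κ : ℝ} (hκ : κ ≤ 1 / 2) (γ : ℝ)
    {G : E → ℝ≥0∞} (hG : Measurable G) (hGD : ∀ z, G z ≠ 0 → 0 < infDist z Γ) :
    ∫⁻ x, ∫⁻ w in {w | ‖w‖ < κ * infDist x Γ},
        ENNReal.ofReal (infDist x Γ ^ γ) * (∫⁻ t in Icc (0 : ℝ) 1, G (x + t • w)) ∂m ∂m
      ≤ ENNReal.ofReal (2 ^ |γ|) * m (ball 0 1) *
        ∫⁻ z, ENNReal.ofReal (infDist z Γ ^ (γ + finrank ℝ E)) * G z ∂m := by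
  have hD : Measurable fun x : E => infDist x Γ := measurable_infDist
  have hS : MeasurableSet {p : E × E | ‖p.2‖ < κ * infDist p.1 Γ} :=
    measurableSet_lt (by fun_prop) ((hD.comp measurable_fst).const_mul κ)
  have hDγ (q : ℝ) : Measurable fun x : E => ENNReal.ofReal (infDist x Γ ^ q) :=
    (hD.pow_const q).ennreal_ofReal
  have hGm : Measurable fun p : (E × E) × ℝ => G (p.1.1 + p.2 • p.1.2) :=
    hG.comp (by fun_prop)
  have hin : Measurable fun p : E × E => ∫⁻ t in Icc (0 : ℝ) 1, G (p.1 + t • p.2) :=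
    Measurable.lintegral_prod_right' (f := fun p : (E × E) × ℝ => G (p.1.1 + p.2 • p.1.2)) hGm
  rw [lintegral_setLIntegral_swap m m (S := fun x w => ‖w‖ < κ * infDist x Γ) hS
    (f := fun x w => ENNReal.ofReal (infDist x Γ ^ γ) * ∫⁻ t in Icc (0 : ℝ) 1, G (x + t • w))
    (((hDγ γ).comp measurable_fst).mul hin)]
  have hinner : ∀ w : E, ∫⁻ x in {x | ‖w‖ < κ * infDist x Γ},
      ENNReal.ofReal (infDist x Γ ^ γ) * (∫⁻ t in Icc (0 : ℝ) 1, G (x + t • w)) ∂m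
      ≤ ∫⁻ z in {z : E | ‖w‖ ≤ infDist z Γ},
        ENNReal.ofReal (2 ^ |γ|) * (ENNReal.ofReal (infDist z Γ ^ γ) * G z) ∂m := by
    intro w
    have hSw : MeasurableSet {x : E | ‖w‖ < κ * infDist x Γ} :=
      measurableSet_lt measurable_const (hD.const_mul κ)
    have hGw : Measurable fun p : E × ℝ => G (p.1 + p.2 • w) := hG.comp (by fun_prop)
    calc _ = ∫⁻ x in {x | ‖w‖ < κ * infDist x Γ}, (∫⁻ t in Icc (0 : ℝ) 1,
          ENNReal.ofReal (infDist x Γ ^ γ) * G (x + t • w)) ∂m := by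
          refine lintegral_congr fun x => ?_
          rw [lintegral_const_mul]
          exact hG.comp (by fun_prop)
      _ = ∫⁻ t in Icc (0 : ℝ) 1, ∫⁻ x in {x | ‖w‖ < κ * infDist x Γ},
          ENNReal.ofReal (infDist x Γ ^ γ) * G (x + t • w) ∂m := by
          rw [lintegral_lintegral_swap]
          exact (((hDγ γ).comp measurable_fst).mul hGw).aemeasurable
      _ ≤ ∫⁻ _t in Icc (0 : ℝ) 1, ∫⁻ z in {z : E | ‖w‖ ≤ infDist z Γ},
          ENNReal.ofReal (2 ^ |γ|) * (ENNReal.ofReal (infDist z Γ ^ γ) * G z) ∂m := by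
          refine setLIntegral_mono' measurableSet_Icc fun t ht => ?_
          rw [← lintegral_indicator hSw, ← lintegral_indicator (measurableSet_le measurable_const hD)]
          refine le_of_le_of_eq (lintegral_mono fun x => ?_) (lintegral_add_right_eq_self _ (t • w))
          by_cases hx : ‖w‖ < κ * infDist x Γ
          swap
          · rw [indicator_of_notMem (by simpa using hx)]
            exact zero_le
          rw [indicator_of_mem (by simpa using hx)]
          by_cases hz0 : G (x + t • w) = 0
          · simp [hz0]
          have hz := hGD _ hz0
          have hw0 := norm_nonneg w
          have hx0 : 0 ≤ infDist x Γ := infDist_nonneg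
          have hκx : κ * infDist x Γ ≤ 1 / 2 * infDist x Γ := by gcongr
          have htw : dist x (x + t • w) ≤ ‖w‖ := by
            rw [dist_self_add_right, norm_smul, Real.norm_of_nonneg ht.1]
            exact mul_le_of_le_one_left hw0 ht.2
          have h1 : infDist x Γ ≤ infDist (x + t • w) Γ + dist x (x + t • w) :=
            infDist_le_infDist_add_dist
          have h2 : infDist (x + t • w) Γ ≤ infDist x Γ + dist (x + t • w) x :=
            infDist_le_infDist_add_dist
          rw [dist_comm] at h2
          rw [indicator_of_mem (show x + t • w ∈ {z : E | ‖w‖ ≤ infDist z Γ} by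
            rw [mem_ofPred_eq]; linarith), ← mul_assoc,
            ← ENNReal.ofReal_mul (by positivity)]
          gcongr
          exact rpow_le_of_comparable one_le_two (by linarith) hz (by linarith) (by linarith) γ
      _ = _ := by simp
  calc _ ≤ ∫⁻ w, ∫⁻ z in {z : E | ‖w‖ ≤ infDist z Γ},
        ENNReal.ofReal (2 ^ |γ|) * (ENNReal.ofReal (infDist z Γ ^ γ) * G z) ∂m ∂m :=
        lintegral_mono hinner
    _ = ∫⁻ z, ∫⁻ w in {w : E | ‖w‖ ≤ infDist z Γ},
        ENNReal.ofReal (2 ^ |γ|) * (ENNReal.ofReal (infDist z Γ ^ γ) * G z) ∂m ∂m := by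
        refine lintegral_setLIntegral_swap m m (S := fun w z => ‖w‖ ≤ infDist z Γ)
          (measurableSet_le (by fun_prop) (hD.comp measurable_snd)) ?_
        exact ((((hDγ γ).mul hG).const_mul _).comp measurable_snd)
    _ = ∫⁻ z, ENNReal.ofReal (2 ^ |γ|) * m (ball 0 1) *
        (ENNReal.ofReal (infDist z Γ ^ (γ + finrank ℝ E)) * G z) ∂m := by
        refine lintegral_congr fun z => ?_
        rw [setLIntegral_const]
        by_cases hz : G z = 0
        · simp [hz]
        have hz' := hGD z hz
        have : {w : E | ‖w‖ ≤ infDist z Γ} = closedBall 0 (infDist z Γ) := by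
          ext; simp
        rw [this, Measure.addHaar_closedBall _ _ hz'.le, Real.rpow_add hz',
          ENNReal.ofReal_mul (by positivity), Real.rpow_natCast]
        ring
    _ = _ := lintegral_const_mul _ ((hDγ _).mul hG)

theorem exists_lintegral_sq_ball_sub_le (Γ : Set E) {κ : ℝ} (hκ0 : 0 < κ) (hκ : κ ≤ 1 / 2)
    (β : ℝ) :
    ∃ C : ℝ≥0∞, C ≠ ∞ ∧ ∀ ψ : E → ℝ, ContDiff ℝ 1 ψ →
      (∀ z, fderiv ℝ ψ z ≠ 0 → 0 < infDist z Γ) →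
      ∫⁻ x, ENNReal.ofReal (infDist x Γ ^ β) *
          (∫⁻ v in ball 0 1, ‖ψ x - ψ (x + (κ * infDist x Γ) • v)‖ₑ ∂m) ^ 2 ∂m
        ≤ C * ∫⁻ z, ENNReal.ofReal (infDist z Γ ^ (β + 2)) * ‖fderiv ℝ ψ z‖ₑ ^ 2 ∂m := by
  set n : ℝ := ((finrank ℝ E : ℕ) : ℝ) with hn
  set V := m (ball (0 : E) 1) with hV
  have hVtop : V ≠ ∞ := measure_ball_lt_top.ne
  refine ⟨V * ENNReal.ofReal (κ ^ (-n)) * (ENNReal.ofReal (2 ^ |β + 2 - n|) * V), by finiteness,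
    fun ψ hψ hsupp => ?_⟩
  have hg : Continuous fun z => ‖fderiv ℝ ψ z‖ₑ := (hψ.continuous_fderiv one_ne_zero).enorm
  have hG : Measurable fun z => ‖fderiv ℝ ψ z‖ₑ ^ 2 := hg.measurable.pow_const 2
  have hmain := lintegral_ball_segment_le m (Γ := Γ) hκ (β + 2 - n) hG
    (fun z hz => hsupp z fun h0 => hz (by rw [h0, ← ofReal_norm, norm_zero]; simp))
  have hexp : β + 2 - n + finrank ℝ E = β + 2 := by rw [← hn]; ring
  rw [hexp] at hmain
  rw [mul_assoc]
  refine le_trans ?_ (mul_le_mul_right hmain _)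
  have hfin : V * ENNReal.ofReal (κ ^ (-n)) ≠ ∞ := by finiteness
  rw [← lintegral_const_mul' _ _ hfin]
  refine lintegral_mono fun x => ?_
  rcases infDist_nonneg.eq_or_lt' (a := infDist x Γ) with hx | hx
  · simp [hx]
  have hr : 0 < κ * infDist x Γ := by positivity
  have hdiff : Measurable fun y => ‖ψ x - ψ y‖ₑ ^ 2 :=
    ((continuous_const.sub hψ.continuous).enorm.measurable.pow_const 2)
  have hcs := lintegral_mul_sq_le (m.restrict (ball (0 : E) 1))
    (f := fun v => ‖ψ x - ψ (x + (κ * infDist x Γ) • v)‖ₑ) (g := fun _ => 1)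
    (continuous_const.sub (hψ.continuous.comp (by fun_prop))).enorm.measurable.aemeasurable
    aemeasurable_const
  simp only [mul_one, one_pow, lintegral_const, Measure.restrict_apply_univ, one_mul] at hcs
  have hsc := setLIntegral_comp_add_smul m hdiff x hr (measurableSet_ball (x := x)
    (ε := κ * infDist x Γ))
  have hset : {v : E | x + (κ * infDist x Γ) • v ∈ ball x (κ * infDist x Γ)} = ball 0 1 := by
    ext v
    simp only [mem_ofPred_eq, mem_ball, dist_self_add_left, norm_smul, Real.norm_of_nonneg hr.le,
      dist_zero_right]
    exact mul_lt_iff_lt_one_right hr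
  have htr := setLIntegral_comp_add_smul m hdiff x one_pos (measurableSet_ball (x := x)
    (ε := κ * infDist x Γ))
  have hset' : {v : E | x + v ∈ ball x (κ * infDist x Γ)}
      = {w | ‖w‖ < κ * infDist x Γ} := by
    ext v; simp
  simp only [one_smul, Real.one_rpow, ENNReal.ofReal_one, one_mul] at htr
  rw [hset'] at htr
  rw [hset, ← htr] at hsc
  rw [hsc] at hcs
  have hwin : ∫⁻ w in {w | ‖w‖ < κ * infDist x Γ}, ‖ψ x - ψ (x + w)‖ₑ ^ 2 ∂m
      ≤ ∫⁻ w in {w | ‖w‖ < κ * infDist x Γ}, ENNReal.ofReal (infDist x Γ ^ (2 : ℝ)) *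
        (∫⁻ t in Icc (0 : ℝ) 1, ‖fderiv ℝ ψ (x + t • w)‖ₑ ^ 2) ∂m := by
    refine setLIntegral_mono' (measurableSet_lt (by fun_prop) (by fun_prop)) fun w hw => ?_
    refine (enorm_sub_sq_le_lintegral_segment hψ x w).trans ?_
    gcongr
    rw [← ofReal_norm, ← ENNReal.ofReal_pow (norm_nonneg _), Real.rpow_two]
    gcongr
    have hw' : ‖w‖ < κ * infDist x Γ := hw
    nlinarith
  have hmeas : Measurable fun w : E =>
      ∫⁻ t in Icc (0 : ℝ) 1, ‖fderiv ℝ ψ (x + t • w)‖ₑ ^ 2 :=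
    Measurable.lintegral_prod_right' (f := fun p : E × ℝ => ‖fderiv ℝ ψ (x + p.2 • p.1)‖ₑ ^ 2)
      (hG.comp (by fun_prop))
  rw [lintegral_const_mul _ hmeas] at hwin ⊢
  calc ENNReal.ofReal (infDist x Γ ^ β) *
        (∫⁻ v in ball 0 1, ‖ψ x - ψ (x + (κ * infDist x Γ) • v)‖ₑ ∂m) ^ 2
      ≤ ENNReal.ofReal (infDist x Γ ^ β) * (ENNReal.ofReal ((κ * infDist x Γ) ^ (-n)) *
        (ENNReal.ofReal (infDist x Γ ^ (2 : ℝ)) * ∫⁻ w in {w | ‖w‖ < κ * infDist x Γ},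
        (∫⁻ t in Icc (0 : ℝ) 1, ‖fderiv ℝ ψ (x + t • w)‖ₑ ^ 2) ∂m) * V) := by
        gcongr
        refine hcs.trans ?_
        gcongr
    _ = _ := by
        have : infDist x Γ ^ (β + 2 - n)
            = infDist x Γ ^ β * infDist x Γ ^ (2 : ℝ) * infDist x Γ ^ (-n) := by
          rw [← Real.rpow_add hx, ← Real.rpow_add hx]; congr 1
        rw [this, Real.mul_rpow hκ0.le hx.le, ENNReal.ofReal_mul (by positivity),
          ENNReal.ofReal_mul (by positivity), ENNReal.ofReal_mul (by positivity)]
        ring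

theorem lintegral_tube_le {γ : ℝ → E} (hγ : Continuous γ) {h : ℝ → ℝ} (hh : Continuous h)
    {l : ℝ} (hpos : ∀ t ∈ Icc 0 l, 0 < h t) {G : E → ℝ≥0∞} (hG : Measurable G)
    {D : E → ℝ} (hD : Measurable D) (S : Set E) {K : ℝ} (hK : 0 < K)
    (hyp : ∀ t ∈ Icc 0 l, ∀ y, G y ≠ 0 → dist y (γ t) < h t →
      y ∈ S ∧ 0 < D y ∧ t ≤ K * D y ∧ D y ≤ K * h t) :
    ∫⁻ v in ball 0 1, (∫⁻ t in Icc 0 l, G (γ t + h t • v)) ∂m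
      ≤ ENNReal.ofReal (K ^ ((finrank ℝ E : ℝ) + 1)) *
        ∫⁻ y in S, G y * ENNReal.ofReal (D y ^ (1 - (finrank ℝ E : ℝ))) ∂m := by
  set n : ℝ := ((finrank ℝ E : ℕ) : ℝ) with hn
  have hn0 : 0 ≤ n := by positivity
  calc _ = ∫⁻ t in Icc 0 l, ∫⁻ v in ball 0 1, G (γ t + h t • v) ∂m := by
        have hm : Measurable fun p : E × ℝ => G (γ p.2 + h p.2 • p.1) := hG.comp (by fun_prop)
        exact lintegral_lintegral_swap hm.aemeasurable
    _ ≤ ∫⁻ t in Icc 0 l, ∫⁻ y in {y | t ∈ Icc 0 (K * D y)},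
          ENNReal.ofReal (K ^ n * D y ^ (-n)) * G y ∂(m.restrict S) := by
        refine setLIntegral_mono' measurableSet_Icc fun t ht => ?_
        have ht0 := hpos t ht
        have hsc := setLIntegral_comp_add_smul m hG (γ t) ht0 (measurableSet_ball (x := γ t)
          (ε := h t))
        have hset : {v : E | γ t + h t • v ∈ ball (γ t) (h t)} = ball 0 1 := by
          ext v
          simp only [mem_ofPred_eq, mem_ball, dist_self_add_left, norm_smul,
            Real.norm_of_nonneg ht0.le, dist_zero_right]
          exact mul_lt_iff_lt_one_right ht0
        have hT : MeasurableSet {y | t ∈ Icc 0 (K * D y)} :=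
          (MeasurableSet.const _).inter (measurableSet_le measurable_const (hD.const_mul K))
        rw [hset] at hsc
        rw [hsc, ← lintegral_const_mul _ hG, Measure.restrict_restrict hT]
        have hsub : ∫⁻ y in ball (γ t) (h t), ENNReal.ofReal (h t ^ (-n)) * G y ∂m
            = ∫⁻ y in ball (γ t) (h t) ∩ Function.support G,
              ENNReal.ofReal (h t ^ (-n)) * G y ∂m := by
          rw [← lintegral_indicator measurableSet_ball, ← lintegral_indicator
            (measurableSet_ball.inter (measurableSet_support hG))]
          refine lintegral_congr fun y => ?_
          by_cases hy : G y = 0 <;> simp [indicator, hy]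
        rw [hsub]
        refine (setLIntegral_mono' (measurableSet_ball.inter (measurableSet_support hG))
          fun y hy => ?_).trans (lintegral_mono_set fun y hy => ?_)
        · obtain ⟨-, hDy, -, h2⟩ := hyp t ht y hy.2 hy.1
          gcongr
          rw [Real.rpow_neg ht0.le, Real.rpow_neg hDy.le, ← Real.inv_rpow ht0.le,
            ← Real.inv_rpow hDy.le, ← Real.mul_rpow hK.le (by positivity)]
          refine Real.rpow_le_rpow (by positivity) ?_ hn0
          rw [inv_le_iff_one_le_mul₀ ht0]
          field_simp
          linarith
        · obtain ⟨hS, -, h1, -⟩ := hyp t ht y hy.2 hy.1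
          exact ⟨⟨ht.1, h1⟩, hS⟩
    _ = ∫⁻ y in S, ∫⁻ t in {t | t ∈ Icc 0 (K * D y)},
          ENNReal.ofReal (K ^ n * D y ^ (-n)) * G y ∂(volume.restrict (Icc 0 l)) ∂m := by
        refine lintegral_setLIntegral_swap (volume.restrict (Icc 0 l)) (m.restrict S)
          (S := fun t y => t ∈ Icc 0 (K * D y)) ?_ ?_
        · exact (measurableSet_le measurable_const measurable_fst).inter
            (measurableSet_le measurable_fst ((hD.comp measurable_snd).const_mul K))
        · exact ((((hD.pow_const _).const_mul _).ennreal_ofReal).mul hG).comp measurable_snd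
    _ ≤ ∫⁻ y in S, ENNReal.ofReal (K ^ (n + 1)) *
          (G y * ENNReal.ofReal (D y ^ (1 - n))) ∂m := by
        refine lintegral_mono fun y => ?_
        rw [setLIntegral_const]
        have hvol : (volume.restrict (Icc 0 l)) {t | t ∈ Icc 0 (K * D y)}
            ≤ ENNReal.ofReal (K * D y) :=
          (Measure.restrict_apply_le _ _).trans_eq (by
            rw [show {t | t ∈ Icc 0 (K * D y)} = Icc 0 (K * D y) from rfl, Real.volume_Icc,
              sub_zero])
        refine (mul_le_mul_right hvol _).trans ?_
        rcases le_or_gt (D y) 0 with hy | hy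
        · rw [ENNReal.ofReal_of_nonpos (mul_nonpos_of_nonneg_of_nonpos hK.le hy)]
          simp
        · refine le_of_eq ?_
          rw [show 1 - n = -n + 1 by ring, Real.rpow_add_one hK.ne', Real.rpow_add_one hy.ne',
            ENNReal.ofReal_mul (by positivity), ENNReal.ofReal_mul (by positivity),
            ENNReal.ofReal_mul (by positivity), ENNReal.ofReal_mul (by positivity)]
          ring
    _ = _ := lintegral_const_mul _ (hG.mul (hD.pow_const _).ennreal_ofReal)

theorem lintegral_ball_enorm_sub_le_tube {ψ : E → ℝ} (hψ : ContDiff ℝ 1 ψ)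
    {γ : ℝ → E} (hγ : LipschitzWith 1 γ) {h : ℝ → ℝ} (hh : LipschitzWith 1 h)
    {l : ℝ} (hl : 0 ≤ l) (hpos : ∀ t ∈ Icc 0 l, 0 < h t)
    {D : E → ℝ} (hD : Measurable D) (S : Set E) {K : ℝ} (hK : 0 < K)
    (hyp : ∀ t ∈ Icc 0 l, ∀ y, fderiv ℝ ψ y ≠ 0 → dist y (γ t) < h t →
      y ∈ S ∧ 0 < D y ∧ t ≤ K * D y ∧ D y ≤ K * h t) :
    ∫⁻ v in ball 0 1, ‖ψ (γ l + h l • v) - ψ (γ 0 + h 0 • v)‖ₑ ∂m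
      ≤ ENNReal.ofReal (2 * K ^ ((finrank ℝ E : ℝ) + 1)) *
        ∫⁻ y in S, ‖fderiv ℝ ψ y‖ₑ * ENNReal.ofReal (D y ^ (1 - (finrank ℝ E : ℝ))) ∂m := by
  have hg : Continuous fun z => ‖fderiv ℝ ψ z‖ₑ := (hψ.continuous_fderiv one_ne_zero).enorm
  rw [ENNReal.ofReal_mul zero_le_two, mul_assoc]
  refine le_trans ?_ (mul_le_mul_right (lintegral_tube_le m hγ.continuous hh.continuous hpos
    hg.measurable hD S hK fun t ht y hy => hyp t ht y fun h0 => hy ?_) _)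
  swap
  · rw [h0, ← ofReal_norm, norm_zero, ENNReal.ofReal_zero]
  rw [← lintegral_const_mul' _ _ ENNReal.ofReal_ne_top]
  refine setLIntegral_mono' measurableSet_ball fun v hv => ?_
  have hv' : ‖v‖ ≤ 1 := by simpa using (mem_ball.1 hv).le
  have hc : LipschitzWith 2 fun t => γ t + h t • v := by
    refine LipschitzWith.of_dist_le_mul fun s t => ?_
    have h1 := hγ.dist_le_mul s t
    have h2 := hh.dist_le_mul s t
    have h3 : dist (h s • v) (h t • v) ≤ dist (h s) (h t) := by
      rw [dist_eq_norm, ← sub_smul, norm_smul, ← dist_eq_norm]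
      exact mul_le_of_le_one_right dist_nonneg hv'
    have h4 := dist_add_add_le (γ s) (h s • v) (γ t) (h t • v)
    simp only [NNReal.coe_one, one_mul, NNReal.coe_ofNat] at *
    linarith
  have := enorm_sub_le_lintegral_fderiv hψ hc hl
  simpa using this

theorem lintegral_infDist_rpow_mul_sq_le {Γ : Set E} (hΓ : IsClosed Γ) (hΓne : Γ.Nonempty)
    (ν : Measure E) [SFinite ν] {A s R K β θ : ℝ} (hK : 1 ≤ K) (hA : 0 < A)
    (hν : ∀ z ∈ Γ, ∀ r, 0 < r → r ≤ R → ENNReal.ofReal (A⁻¹ * r ^ s) ≤ ν (Γ ∩ closedBall z r) ∧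
      ν (Γ ∩ closedBall z r) ≤ ENNReal.ofReal (A * r ^ s))
    {T U₁ U₂ : ℝ → ℝ → Prop} (hT : MeasurableSet {p : ℝ × ℝ | T p.1 p.2})
    (hU₁ : ∀ a b c, 0 < a → 0 < b → T a b → b ≤ c → c ≤ K * b → U₁ a c)
    (hU₂ : ∀ a b c, 0 < a → 0 < b → T a b → a ≤ c → c ≤ 2 * a → U₂ b c) {C₁ C₂ : ℝ≥0∞}
    (h₁ : ∀ z : E, ∀ η : ℝ, 0 < η → ∫⁻ y in {y | U₁ η (dist y z)},
      ENNReal.ofReal (dist y z ^ (θ - (finrank ℝ E : ℝ))) ∂m ≤ C₁ * ENNReal.ofReal (η ^ θ))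
    (h₂ : ∀ z : E, ∀ η : ℝ, 0 < η → ∫⁻ x in {x | U₂ η (dist x z)},
      ENNReal.ofReal (dist x z ^ (β + θ - s)) ∂m
        ≤ C₂ * ENNReal.ofReal (η ^ (β + θ - s + finrank ℝ E)))
    {G : E → ℝ≥0∞} (hG : Measurable G)
    (hGR : ∀ y, G y ≠ 0 → 0 < infDist y Γ ∧ (K + 1) * infDist y Γ ≤ R)
    {F : E → ℝ≥0∞} (hFR : ∀ x, F x ≠ 0 → 0 < infDist x Γ ∧ infDist x Γ ≤ R)
    (hF : ∀ x, F x ≠ 0 → ∀ ω ∈ Γ, dist x ω ≤ 2 * infDist x Γ → F x ≤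
      ∫⁻ y in {y | dist y ω ≤ K * infDist y Γ ∧ 0 < infDist y Γ ∧ T (infDist x Γ) (infDist y Γ)},
        G y * ENNReal.ofReal (infDist y Γ ^ (1 - (finrank ℝ E : ℝ))) ∂m) :
    ∫⁻ x, ENNReal.ofReal (infDist x Γ ^ β) * F x ^ 2 ∂m
      ≤ ENNReal.ofReal A * (ENNReal.ofReal (K ^ |θ - finrank ℝ E|) * C₁) *
        (ENNReal.ofReal (2 ^ |β + θ - s|) * C₂) * ENNReal.ofReal (A * (K + 1) ^ s) *
        ∫⁻ y, ENNReal.ofReal (infDist y Γ ^ (β + 2)) * G y ^ 2 ∂m := by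
  set n : ℝ := ((finrank ℝ E : ℕ) : ℝ) with hn
  set q : ℝ := β + θ - s with hq
  have hD : Measurable fun x : E => infDist x Γ := measurable_infDist
  have hDp (q : ℝ) : Measurable fun x : E => ENNReal.ofReal (infDist x Γ ^ q) :=
    (hD.pow_const q).ennreal_ofReal
  have hTa (a : ℝ) : MeasurableSet {b | T a b} :=
    (measurable_const.prodMk measurable_id : Measurable fun b : ℝ => (a, b)) hT
  have hTb (b : ℝ) : MeasurableSet {a | T a b} :=
    (measurable_id.prodMk measurable_const : Measurable fun a : ℝ => (a, b)) hT
  set H : E → ℝ≥0∞ := fun y => G y ^ 2 * ENNReal.ofReal (infDist y Γ ^ (2 - n - θ)) with hH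
  have hHm : Measurable H := (hG.pow_const 2).mul (hDp _)
  let X : E → E → Prop := fun x ω => dist x ω ≤ 2 * infDist x Γ ∧ 0 < infDist x Γ
  let Y : E → E → E → Prop := fun x ω y =>
    dist y ω ≤ K * infDist y Γ ∧ 0 < infDist y Γ ∧ T (infDist x Γ) (infDist y Γ)
  have hmX : MeasurableSet {p : (E × E) × E | X p.1.1 p.1.2} :=
    (measurableSet_le (by fun_prop) ((hD.comp (by fun_prop)).const_mul 2)).inter
      (measurableSet_lt measurable_const (hD.comp (by fun_prop)))
  have hmY : MeasurableSet {p : (E × E) × E | Y p.1.1 p.1.2 p.2} :=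
    (measurableSet_le (by fun_prop) ((hD.comp (by fun_prop)).const_mul K)).inter
      ((measurableSet_lt measurable_const (hD.comp (by fun_prop))).inter
        (((hD.comp (by fun_prop)).prodMk (hD.comp (by fun_prop)) :
          Measurable fun p : (E × E) × E => (infDist p.1.1 Γ, infDist p.2 Γ)) hT))
  let J : (E × E) × E → ℝ≥0∞ := ({p | X p.1.1 p.1.2} ∩ {p | Y p.1.1 p.1.2 p.2}).indicator
    fun p => ENNReal.ofReal (infDist p.1.1 Γ ^ q) * H p.2
  have hJ : Measurable J := (((hDp q).comp (by fun_prop)).mul (hHm.comp (by fun_prop))).indicator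
    (hmX.inter hmY)
  have step1 : ∀ x, ENNReal.ofReal (infDist x Γ ^ β) * F x ^ 2
      ≤ ENNReal.ofReal A * (ENNReal.ofReal (K ^ |θ - n|) * C₁) *
        ∫⁻ ω in Γ, ∫⁻ y, J ((x, ω), y) ∂m ∂ν := by
    intro x
    by_cases hFx : F x = 0
    · simp [hFx]
    obtain ⟨hx, hxR⟩ := hFR x hFx
    obtain ⟨ω₀, hω₀, hω₀d⟩ := hΓ.exists_infDist_eq_dist hΓne x
    set B := Γ ∩ {ω | dist x ω ≤ 2 * infDist x Γ} with hB
    have hBm : MeasurableSet B :=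
      hΓ.measurableSet.inter (measurableSet_le (by fun_prop) measurable_const)
    have hνB : ENNReal.ofReal (A⁻¹ * infDist x Γ ^ s) ≤ ν B := by
      refine (hν ω₀ hω₀ _ hx hxR).1.trans (measure_mono (inter_subset_inter_right _ fun ω hω => ?_))
      have h1 := dist_triangle_right x ω ω₀
      have h2 : dist ω ω₀ ≤ infDist x Γ := hω
      rw [mem_ofPred_eq]
      linarith
    have hone : 1 ≤ ENNReal.ofReal A * ENNReal.ofReal (infDist x Γ ^ (-s)) * ν B := by
      refine le_trans ?_ (mul_le_mul_right hνB _)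
      rw [← ENNReal.ofReal_mul hA.le, ← ENNReal.ofReal_mul (by positivity), Real.rpow_neg hx.le,
        show A * (infDist x Γ ^ s)⁻¹ * (A⁻¹ * infDist x Γ ^ s) = 1 by
          have : 0 < infDist x Γ ^ s := by positivity
          field_simp, ENNReal.ofReal_one]
    have hω : ∀ ω ∈ B, ENNReal.ofReal (infDist x Γ ^ (β - s)) * F x ^ 2
        ≤ ENNReal.ofReal (K ^ |θ - n|) * C₁ * ∫⁻ y, J ((x, ω), y) ∂m := by
      intro ω hω
      have hYm : MeasurableSet {y | Y x ω y} :=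
        (by fun_prop : Measurable fun y : E => ((x, ω), y)) hmY
      have hJx : ∫⁻ y, J ((x, ω), y) ∂m
          = ENNReal.ofReal (infDist x Γ ^ q) * ∫⁻ y in {y | Y x ω y}, H y ∂m := by
        rw [← lintegral_const_mul _ hHm, ← lintegral_indicator hYm]
        refine lintegral_congr fun y => ?_
        have hX : X x ω := ⟨hω.2, hx⟩
        by_cases hY : Y x ω y <;> simp [J, indicator, hX, hY]
      have h := sq_setLIntegral_infDist_le m hω.1 hK θ (hTa (infDist x Γ))
        (fun b c hb hP => hU₁ _ b c hx hb hP) hG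
      calc _ ≤ ENNReal.ofReal (infDist x Γ ^ (β - s)) * (ENNReal.ofReal (K ^ |θ - n|) *
            (C₁ * ENNReal.ofReal (infDist x Γ ^ θ)) * ∫⁻ y in {y | Y x ω y}, H y ∂m) := by
            gcongr
            refine (pow_le_pow_left' (hF x hFx ω hω.1 hω.2) 2).trans (h.trans ?_)
            gcongr
            exact h₁ ω _ hx
        _ = _ := by
            rw [hJx, show q = (β - s) + θ by rw [hq]; ring, Real.rpow_add hx,
              ENNReal.ofReal_mul (by positivity)]
            ring
    calc ENNReal.ofReal (infDist x Γ ^ β) * F x ^ 2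
        ≤ ENNReal.ofReal (infDist x Γ ^ β) * F x ^ 2 *
          (ENNReal.ofReal A * ENNReal.ofReal (infDist x Γ ^ (-s)) * ν B) :=
          le_mul_of_one_le_right' hone
      _ = ENNReal.ofReal A * ∫⁻ _ω in B, ENNReal.ofReal (infDist x Γ ^ (β - s)) * F x ^ 2 ∂ν := by
          rw [setLIntegral_const, sub_eq_add_neg, Real.rpow_add hx,
            ENNReal.ofReal_mul (by positivity)]
          ring
      _ ≤ ENNReal.ofReal A * ∫⁻ ω in B,
          ENNReal.ofReal (K ^ |θ - n|) * C₁ * (∫⁻ y, J ((x, ω), y) ∂m) ∂ν := by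
          exact mul_le_mul_right (setLIntegral_mono' hBm hω) _
      _ ≤ ENNReal.ofReal A * ∫⁻ ω in Γ,
          ENNReal.ofReal (K ^ |θ - n|) * C₁ * (∫⁻ y, J ((x, ω), y) ∂m) ∂ν := by
          gcongr
          exact inter_subset_left
      _ = _ := by
          have hm : Measurable fun ω => ∫⁻ y, J ((x, ω), y) ∂m :=
            Measurable.lintegral_prod_right' (f := fun p : E × E => J ((x, p.1), p.2))
              (hJ.comp (by fun_prop))
          rw [lintegral_const_mul _ hm]
          ring
  have step2 : ∀ ω ∈ Γ, ∀ y, ∫⁻ x, J ((x, ω), y) ∂m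
      ≤ {y | dist y ω ≤ K * infDist y Γ ∧ 0 < infDist y Γ}.indicator
        (fun y => ENNReal.ofReal (2 ^ |q|) * C₂ *
          (ENNReal.ofReal (infDist y Γ ^ (q + n)) * H y)) y := by
    intro ω hω y
    by_cases hy : y ∈ {y | dist y ω ≤ K * infDist y Γ ∧ 0 < infDist y Γ}
    swap
    · have : ∀ x, J ((x, ω), y) = 0 := fun x =>
        indicator_of_notMem (fun h => hy ⟨h.2.1, h.2.2.1⟩) _
      simp [this]
    rw [indicator_of_mem hy]
    have hXm : MeasurableSet
        {x | dist x ω ≤ 2 * infDist x Γ ∧ 0 < infDist x Γ ∧ T (infDist x Γ) (infDist y Γ)} :=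
      (measurableSet_le (by fun_prop) (hD.const_mul 2)).inter
        ((measurableSet_lt measurable_const hD).inter (hD (hTb (infDist y Γ))))
    have h := setLIntegral_infDist_rpow_le m hω one_le_two q (hTb (infDist y Γ))
      (fun a c ha hP => hU₂ a _ c ha hy.2 hP)
    calc _ = ∫⁻ x in {x | dist x ω ≤ 2 * infDist x Γ ∧ 0 < infDist x Γ ∧
            T (infDist x Γ) (infDist y Γ)}, ENNReal.ofReal (infDist x Γ ^ q) * H y ∂m := by
          rw [← lintegral_indicator hXm]
          refine lintegral_congr fun x => ?_
          by_cases hx : x ∈ {x | dist x ω ≤ 2 * infDist x Γ ∧ 0 < infDist x Γ ∧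
              T (infDist x Γ) (infDist y Γ)}
          · rw [indicator_of_mem hx]
            exact indicator_of_mem (show ((x, ω), y) ∈ {p : (E × E) × E | X p.1.1 p.1.2} ∩
              {p | Y p.1.1 p.1.2 p.2} from ⟨⟨hx.1, hx.2.1⟩, hy.1, hy.2, hx.2.2⟩) _
          · rw [indicator_of_notMem hx]
            exact indicator_of_notMem (fun h => hx ⟨h.1.1, h.1.2, h.2.2.2⟩) _
      _ = (∫⁻ x in {x | dist x ω ≤ 2 * infDist x Γ ∧ 0 < infDist x Γ ∧
            T (infDist x Γ) (infDist y Γ)}, ENNReal.ofReal (infDist x Γ ^ q) ∂m) * H y :=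
          lintegral_mul_const _ (hDp q)
      _ ≤ ENNReal.ofReal (2 ^ |q|) * (C₂ * ENNReal.ofReal (infDist y Γ ^ (q + n))) * H y := by
          gcongr
          refine h.trans ?_
          gcongr
          exact h₂ ω _ hy.2
      _ = _ := by ring
  have step3 : ∀ y, ENNReal.ofReal (infDist y Γ ^ (q + n)) * H y *
      (ν.restrict Γ {ω | dist y ω ≤ K * infDist y Γ ∧ 0 < infDist y Γ})
      ≤ ENNReal.ofReal (A * (K + 1) ^ s) *
        (ENNReal.ofReal (infDist y Γ ^ (β + 2)) * G y ^ 2) := by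
    intro y
    by_cases hGy : G y = 0
    · simp [hH, hGy]
    obtain ⟨hy, hyR⟩ := hGR y hGy
    obtain ⟨ω₀, hω₀, hω₀d⟩ := hΓ.exists_infDist_eq_dist hΓne y
    have hνy : ν.restrict Γ {ω | dist y ω ≤ K * infDist y Γ ∧ 0 < infDist y Γ}
        ≤ ENNReal.ofReal (A * ((K + 1) * infDist y Γ) ^ s) := by
      refine le_trans ?_ (hν ω₀ hω₀ _ (by positivity) hyR).2
      rw [Measure.restrict_apply' hΓ.measurableSet, inter_comm]
      refine measure_mono (inter_subset_inter_right _ fun ω hω => ?_)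
      have h1 := dist_triangle_left ω ω₀ y
      have h2 := hω.1
      rw [mem_closedBall]
      linarith
    refine (mul_le_mul_right hνy _).trans_eq ?_
    rw [Real.mul_rpow (by positivity) hy.le, ← mul_assoc A,
      ENNReal.ofReal_mul (p := A * (K + 1) ^ s) (by positivity),
      show β + 2 = (q + n) + (2 - n - θ) + s by rw [hq]; ring,
      Real.rpow_add hy (q + n + (2 - n - θ)) s, Real.rpow_add hy (q + n) (2 - n - θ),
      ENNReal.ofReal_mul (p := infDist y Γ ^ (q + n) * _) (by positivity),
      ENNReal.ofReal_mul (p := infDist y Γ ^ (q + n)) (by positivity), hH]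
    ring
  have hJω : Measurable fun p : E × E => ∫⁻ y, J (p, y) ∂m := hJ.lintegral_prod_right'
  set c₁ := ENNReal.ofReal A * (ENNReal.ofReal (K ^ |θ - n|) * C₁) with hc₁
  set c₂ := ENNReal.ofReal (2 ^ |q|) * C₂ with hc₂
  have hZ : MeasurableSet {p : E × E | dist p.2 p.1 ≤ K * infDist p.2 Γ ∧ 0 < infDist p.2 Γ} :=
    (measurableSet_le (by fun_prop) ((hD.comp (by fun_prop)).const_mul K)).inter
      (measurableSet_lt measurable_const (hD.comp (by fun_prop)))
  have hZω (ω : E) : MeasurableSet {y | dist y ω ≤ K * infDist y Γ ∧ 0 < infDist y Γ} :=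
    (by fun_prop : Measurable fun y : E => (ω, y)) hZ
  have hmeas : Measurable fun y => c₂ * (ENNReal.ofReal (infDist y Γ ^ (q + n)) * H y) :=
    ((hDp _).mul hHm).const_mul _
  calc _ ≤ ∫⁻ x, c₁ * (∫⁻ ω in Γ, ∫⁻ y, J ((x, ω), y) ∂m ∂ν) ∂m := lintegral_mono step1
    _ = c₁ * ∫⁻ x, ∫⁻ ω in Γ, ∫⁻ y, J ((x, ω), y) ∂m ∂ν ∂m :=
        lintegral_const_mul _ hJω.lintegral_prod_right'
    _ = c₁ * ∫⁻ ω in Γ, ∫⁻ x, ∫⁻ y, J ((x, ω), y) ∂m ∂m ∂ν := by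
        congr 1
        exact lintegral_lintegral_swap hJω.aemeasurable
    _ ≤ c₁ * ∫⁻ ω in Γ, ∫⁻ y in {y | dist y ω ≤ K * infDist y Γ ∧ 0 < infDist y Γ},
          c₂ * (ENNReal.ofReal (infDist y Γ ^ (q + n)) * H y) ∂m ∂ν := by
        refine mul_le_mul_right (setLIntegral_mono' hΓ.measurableSet fun ω hω => ?_) _
        have hm : Measurable fun p : E × E => J ((p.1, ω), p.2) := hJ.comp (by fun_prop)
        rw [lintegral_lintegral_swap hm.aemeasurable, ← lintegral_indicator (hZω ω)]
        exact lintegral_mono (step2 ω hω)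
    _ = c₁ * ∫⁻ y, c₂ * (ENNReal.ofReal (infDist y Γ ^ (q + n)) * H y *
          (ν.restrict Γ {ω | dist y ω ≤ K * infDist y Γ ∧ 0 < infDist y Γ})) ∂m := by
        congr 1
        refine (lintegral_setLIntegral_swap (ν.restrict Γ) m
          (S := fun ω y => dist y ω ≤ K * infDist y Γ ∧ 0 < infDist y Γ) hZ
          (hmeas.comp measurable_snd)).trans (lintegral_congr fun y => ?_)
        rw [setLIntegral_const, mul_assoc]
    _ ≤ c₁ * ∫⁻ y, c₂ * (ENNReal.ofReal (A * (K + 1) ^ s) *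
          (ENNReal.ofReal (infDist y Γ ^ (β + 2)) * G y ^ 2)) ∂m := by
        exact mul_le_mul_right (lintegral_mono fun y => mul_le_mul_right (step3 y) _) _
    _ = _ := by
        have hm : Measurable fun y => ENNReal.ofReal (infDist y Γ ^ (β + 2)) * G y ^ 2 :=
          (hDp _).mul (hG.pow_const 2)
        rw [lintegral_const_mul _ (hm.const_mul _), lintegral_const_mul _ hm]
        simp only [mul_assoc]

theorem lintegral_ball_enorm_le_of_far {Ω : Set E} {σ : ℝ} (hσ : 1 ≤ σ) {ψ : E → ℝ}
    (hψ : ContDiff ℝ 1 ψ) {r : ℝ} (hψr : ∀ y, ψ y ≠ 0 → infDist y (frontier Ω) < r)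
    {γ : ℝ → E} (hγ : LipschitzWith 1 γ) {l : ℝ} (hl : 12 * σ * r ≤ l)
    (hγD : ∀ t ∈ Icc 0 l, σ⁻¹ * min t (l - t) ≤ infDist (γ t) (frontier Ω))
    (hx : 0 < infDist (γ 0) (frontier Ω)) (hxr : infDist (γ 0) (frontier Ω) < r)
    {ω : E} (hxω : dist (γ 0) ω ≤ 2 * infDist (γ 0) (frontier Ω)) :
    ∫⁻ v in ball 0 1, ‖ψ (γ 0 + ((6 * σ)⁻¹ * infDist (γ 0) (frontier Ω)) • v)‖ₑ ∂m
      ≤ ENNReal.ofReal (2 * (50 * σ ^ 2) ^ ((finrank ℝ E : ℝ) + 1)) *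
        ∫⁻ y in {y | dist y ω ≤ 50 * σ ^ 2 * infDist y (frontier Ω) ∧ 0 < infDist y (frontier Ω) ∧
            infDist (γ 0) (frontier Ω) ≤ 50 * σ ^ 2 * infDist y (frontier Ω)},
          ‖fderiv ℝ ψ y‖ₑ * ENNReal.ofReal (infDist y (frontier Ω) ^ (1 - (finrank ℝ E : ℝ))) ∂m := by
  set Γ := frontier Ω
  set ρ := infDist (γ 0) Γ with hρ
  have hr : 0 < r := hx.trans hxr
  have hσ0 : 0 < σ := by linarith
  have hκ : 0 < (6 * σ)⁻¹ := by positivity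
  have hκ1 : (6 * σ)⁻¹ ≤ 1 / 6 := by
    rw [one_div]; exact inv_anti₀ (by norm_num) (by linarith)
  set T := 6 * σ * r with hT
  have hT0 : 0 < T := by positivity
  let h : ℝ → ℝ := fun t => (6 * σ)⁻¹ * (ρ + t)
  have hh : LipschitzWith 1 h := by
    refine LipschitzWith.of_dist_le_mul fun s t => ?_
    simp only [h, Real.dist_eq, ← mul_sub, add_sub_add_left_eq_sub, abs_mul, abs_of_pos hκ,
      NNReal.coe_one]
    gcongr
    linarith
  have hlow : ∀ t ∈ Icc 0 T, 2 * h t ≤ infDist (γ t) Γ := by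
    intro t ht
    have h1 := (infDist_le_infDist_add_sub (Γ := Γ) hγ ht.1).1
    have h2 := hγD t ⟨ht.1, by linarith [ht.2]⟩
    rw [min_eq_left (by linarith [ht.2]), inv_mul_le_iff₀ hσ0] at h2
    have h3 : 2 * h t = (ρ + t) / (3 * σ) := by simp only [h]; field_simp; ring
    rw [h3, div_le_iff₀ (by positivity)]
    have h4 : 0 ≤ infDist (γ t) Γ := infDist_nonneg
    nlinarith
  have hnear : ∀ t ∈ Icc 0 T, ∀ y, dist y (γ t) < h t → ρ + t ≤ 6 * σ * infDist y Γ := by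
    intro t ht y hy
    have h1 : infDist (γ t) Γ ≤ infDist y Γ + dist (γ t) y := infDist_le_infDist_add_dist
    have h2 := hlow t ht
    rw [dist_comm] at h1
    have h3 : h t ≤ infDist y Γ := by linarith
    rwa [inv_mul_le_iff₀ (by positivity)] at h3
  have hσσ : 18 * σ ≤ 50 * σ ^ 2 := by nlinarith
  have key := lintegral_ball_enorm_sub_le_tube m hψ hγ hh hT0.le
    (fun t ht => mul_pos hκ (by linarith [ht.1])) (D := fun y => infDist y Γ) measurable_infDist
    {y | dist y ω ≤ 50 * σ ^ 2 * infDist y Γ ∧ 0 < infDist y Γ ∧ ρ ≤ 50 * σ ^ 2 * infDist y Γ}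
    (K := 50 * σ ^ 2) (by positivity) (fun t ht y _ hy => by
      have h1 := hnear t ht y hy
      have ht0 := ht.1
      have hy0 : 0 < infDist y Γ := by
        by_contra hcon
        nlinarith
      have h2 : 18 * σ * infDist y Γ ≤ 50 * σ ^ 2 * infDist y Γ := by gcongr
      have h3 : h t ≤ 1 / 6 * (ρ + t) := by simp only [h]; gcongr
      have h4 := hγ.dist_le_mul t 0
      rw [NNReal.coe_one, one_mul, Real.dist_eq, sub_zero, abs_of_nonneg ht0] at h4
      have h5 := dist_triangle y (γ t) ω
      have h6 := dist_triangle (γ t) (γ 0) ω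
      have h7 : infDist y Γ ≤ infDist (γ t) Γ + dist y (γ t) := infDist_le_infDist_add_dist
      have h8 := (infDist_le_infDist_add_sub (Γ := Γ) hγ ht0).2
      refine ⟨⟨by linarith, hy0, by linarith⟩, hy0, by linarith, ?_⟩
      have h9 : 12 * σ * h t = 2 * (ρ + t) := by simp only [h]; field_simp; ring
      have h10 : 12 * σ * h t ≤ 50 * σ ^ 2 * h t := by
        have : 0 ≤ h t := mul_nonneg hκ.le (by linarith)
        exact mul_le_mul_of_nonneg_right (by nlinarith) this
      linarith)
  refine le_of_eq_of_le (setLIntegral_congr_fun measurableSet_ball fun v hv => ?_) key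
  have hend : ψ (γ T + h T • v) = 0 := by
    by_contra hne
    have h1 := hψr _ hne
    have hhT : 0 < h T := mul_pos hκ (by linarith)
    have h2 := hnear T ⟨hT0.le, le_rfl⟩ (γ T + h T • v) (by
      rw [dist_self_add_left, norm_smul, Real.norm_of_nonneg hhT.le]
      exact mul_lt_of_lt_one_right hhT (by simpa using hv))
    nlinarith
  simp only [hend, zero_sub, enorm_neg, h, add_zero]

theorem lintegral_ball_enorm_le_of_near {Ω : Set E} {σ : ℝ} (hσ : 1 ≤ σ) {ψ : E → ℝ}
    (hψ : ContDiff ℝ 1 ψ) {ε : ℝ} (hψε : ∀ y, ψ y ≠ 0 → ε ≤ infDist y (frontier Ω))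
    (hdψε : ∀ y, fderiv ℝ ψ y ≠ 0 → ε ≤ infDist y (frontier Ω))
    {γ : ℝ → E} (hγ : LipschitzWith 1 γ) {l : ℝ} (hl0 : 0 ≤ l) (hl : l ≤ σ * dist (γ 0) (γ l))
    (hγD : ∀ t ∈ Icc 0 l, σ⁻¹ * min t (l - t) ≤ infDist (γ t) (frontier Ω))
    (hx : 0 < infDist (γ l) (frontier Ω)) (hx' : 0 < infDist (γ 0) (frontier Ω))
    {ω : E} (hω : ω ∈ frontier Ω) (hxω : dist (γ l) ω ≤ 2 * infDist (γ l) (frontier Ω))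
    (hx'ε : dist (γ 0) ω < ε / 2) (hx'ω : dist (γ 0) ω < infDist (γ l) (frontier Ω) / 2) :
    ∫⁻ v in ball 0 1, ‖ψ (γ l + ((6 * σ)⁻¹ * infDist (γ l) (frontier Ω)) • v)‖ₑ ∂m
      ≤ ENNReal.ofReal (2 * (50 * σ ^ 2) ^ ((finrank ℝ E : ℝ) + 1)) *
        ∫⁻ y in {y | dist y ω ≤ 50 * σ ^ 2 * infDist y (frontier Ω) ∧ 0 < infDist y (frontier Ω) ∧
            infDist y (frontier Ω) ≤ 50 * σ ^ 2 * infDist (γ l) (frontier Ω)},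
          ‖fderiv ℝ ψ y‖ₑ * ENNReal.ofReal (infDist y (frontier Ω) ^ (1 - (finrank ℝ E : ℝ))) ∂m := by
  set Γ := frontier Ω
  set ρ := infDist (γ l) Γ with hρ
  set ρ' := infDist (γ 0) Γ with hρ'
  have hσ0 : 0 < σ := by linarith
  have hκ : 0 < (6 * σ)⁻¹ := by positivity
  have hκ1 : (6 * σ)⁻¹ ≤ 1 / 6 := by
    rw [one_div]; exact inv_anti₀ (by norm_num) (by linarith)
  have hρ'ω : ρ' ≤ dist (γ 0) ω := infDist_le_dist_of_mem hω
  have hlρ : l ≤ 5 / 2 * σ * ρ := by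
    have := dist_triangle_right (γ 0) (γ l) ω
    nlinarith
  have hρl : ρ ≤ ρ' + l := by
    have := (infDist_le_infDist_add_sub (Γ := Γ) hγ hl0).2
    linarith
  let M : ℝ → ℝ := fun t => min (ρ' + t) ρ
  let h : ℝ → ℝ := fun t => (6 * σ)⁻¹ * M t
  have hM : LipschitzWith 1 M := by
    refine LipschitzWith.min_const (LipschitzWith.of_dist_le_mul fun s t => ?_) ρ
    simp [Real.dist_eq]
  have hh : LipschitzWith 1 h := by
    refine LipschitzWith.of_dist_le_mul fun s t => ?_
    have := hM.dist_le_mul s t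
    rw [NNReal.coe_one, one_mul] at this ⊢
    refine le_trans ?_ this
    simp only [h, Real.dist_eq, ← mul_sub, abs_mul, abs_of_pos hκ]
    exact mul_le_of_le_one_left (abs_nonneg _) (by linarith)
  have hMpos : ∀ t ∈ Icc 0 l, 0 < M t := fun t ht => lt_min (by linarith [ht.1]) hx
  have hMσ : ∀ t, M t = 6 * σ * h t := fun t => by simp only [h]; field_simp
  have hlow : ∀ t ∈ Icc 0 l, M t ≤ 3 * σ * infDist (γ t) Γ := by
    intro t ht
    have h1 := (infDist_le_infDist_add_sub (Γ := Γ) hγ ht.1).1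
    have h2 := (infDist_le_infDist_add_sub (Γ := Γ) hγ ht.2).2
    have h3 := hγD t ht
    have h4 : 0 ≤ infDist (γ t) Γ := infDist_nonneg
    rw [inv_mul_le_iff₀ hσ0] at h3
    rcases le_total t (l - t) with h5 | h5
    · rw [min_eq_left h5] at h3
      refine (min_le_left _ _).trans ?_
      nlinarith
    · rw [min_eq_right h5] at h3
      refine (min_le_right _ _).trans ?_
      nlinarith
  have hup : ∀ t ∈ Icc 0 l, ρ' + t ≤ 4 * σ * M t := by
    intro t ht
    rcases le_total (ρ' + t) ρ with h1 | h1
    · simp only [M, min_eq_left h1]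
      nlinarith [ht.1]
    · simp only [M, min_eq_right h1]
      nlinarith [ht.2]
  have h0l : (0 : ℝ) ∈ Icc 0 l := ⟨le_rfl, hl0⟩
  have key := lintegral_ball_enorm_sub_le_tube m hψ hγ hh hl0
    (fun t ht => mul_pos hκ (hMpos t ht)) (D := fun y => infDist y Γ) measurable_infDist
    {y | dist y ω ≤ 50 * σ ^ 2 * infDist y Γ ∧ 0 < infDist y Γ ∧ infDist y Γ ≤ 50 * σ ^ 2 * ρ}
    (K := 50 * σ ^ 2) (by positivity) (fun t ht y hy hyt => by
      have hMp := hMpos t ht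
      have hm := hMσ t
      have h1 : infDist (γ t) Γ ≤ infDist y Γ + dist (γ t) y := infDist_le_infDist_add_dist
      rw [dist_comm] at h1
      have h2 : M t ≤ 6 * σ * infDist y Γ := by nlinarith [hlow t ht]
      have hy0 : 0 < infDist y Γ := by
        by_contra hcon
        nlinarith
      have h3 := hup t ht
      have h4 : ρ' + t ≤ 24 * σ ^ 2 * infDist y Γ := by nlinarith
      have hht : h t ≤ 1 / 6 * M t := by simp only [h]; gcongr
      have hh0 : 0 < h t := mul_pos hκ hMp
      have h5 := hγ.dist_le_mul t 0
      rw [NNReal.coe_one, one_mul, Real.dist_eq, sub_zero, abs_of_nonneg ht.1] at h5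
      have h6 := dist_triangle y (γ t) ω
      have h7 := dist_triangle (γ t) (γ 0) ω
      have h8 : infDist y Γ ≤ infDist (γ t) Γ + dist y (γ t) := infDist_le_infDist_add_dist
      have h9 := (infDist_le_infDist_add_sub (Γ := Γ) hγ ht.1).2
      have h10 := hdψε y hy
      have hσσ : σ ≤ σ ^ 2 := by nlinarith
      have h11 : σ * infDist y Γ ≤ σ ^ 2 * infDist y Γ := by gcongr
      have h12 : 1 * infDist y Γ ≤ σ * infDist y Γ := by gcongr
      have h13 : 1 * M t ≤ σ * M t := by gcongr
      have h14 : infDist y Γ ≤ 5 * σ * M t := by linarith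
      have h15 : M t ≤ ρ := min_le_right _ _
      have h16 : σ * M t ≤ σ ^ 2 * ρ := by gcongr
      have h17 : 0 ≤ σ ^ 2 * h t := by positivity
      have h18 : 0 ≤ σ ^ 2 * ρ := by positivity
      have h19 : 0 ≤ σ ^ 2 * infDist y Γ := by positivity
      refine ⟨⟨by linarith, hy0, by linarith⟩, hy0, by linarith, ?_⟩
      rw [hm] at h14
      linarith)
  have hend : ∀ v ∈ ball (0 : E) 1, ψ (γ 0 + h 0 • v) = 0 := by
    intro v hv
    by_contra hne
    have h1 := hψε _ hne
    have hh0 : 0 < h 0 := mul_pos hκ (hMpos 0 h0l)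
    have h2 : infDist (γ 0 + h 0 • v) Γ ≤ ρ' + dist (γ 0 + h 0 • v) (γ 0) :=
      infDist_le_infDist_add_dist
    have h3 : dist (γ 0 + h 0 • v) (γ 0) < h 0 := by
      rw [dist_self_add_left, norm_smul, Real.norm_of_nonneg hh0.le]
      exact mul_lt_of_lt_one_right hh0 (by simpa using hv)
    have h4 : h 0 ≤ 1 / 6 * M 0 := by
      simp only [h]
      have := (hMpos 0 h0l).le
      gcongr
    have h5 : M 0 ≤ ρ' + 0 := min_le_left _ _
    linarith
  refine le_of_eq_of_le (setLIntegral_congr_fun measurableSet_ball fun v hv => ?_) key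
  simp only [hend v hv, sub_zero, h, M, min_eq_right hρl]

theorem exists_lintegral_rpow_infDist_mul_enorm_sq_le {Γ : Set E} (hΓ : IsClosed Γ)
    (hΓne : Γ.Nonempty) (ν : Measure E) [SFinite ν] {A s R K β θ : ℝ} (hK : 1 ≤ K) (hA : 0 < A)
    (hν : ∀ z ∈ Γ, ∀ r, 0 < r → r ≤ R → ENNReal.ofReal (A⁻¹ * r ^ s) ≤ ν (Γ ∩ closedBall z r) ∧
      ν (Γ ∩ closedBall z r) ≤ ENNReal.ofReal (A * r ^ s))
    {T U₁ U₂ : ℝ → ℝ → Prop} (hT : MeasurableSet {p : ℝ × ℝ | T p.1 p.2})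
    (hU₁ : ∀ a b c, 0 < a → 0 < b → T a b → b ≤ c → c ≤ K * b → U₁ a c)
    (hU₂ : ∀ a b c, 0 < a → 0 < b → T a b → a ≤ c → c ≤ 2 * a → U₂ b c) {C₁ C₂ : ℝ≥0∞}
    (hC₁ : C₁ ≠ ∞) (hC₂ : C₂ ≠ ∞)
    (h₁ : ∀ (z : E) (η : ℝ), 0 < η → ∫⁻ y in {y | U₁ η (dist y z)},
      ENNReal.ofReal (dist y z ^ (θ - (finrank ℝ E : ℝ))) ∂m ≤ C₁ * ENNReal.ofReal (η ^ θ))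
    (h₂ : ∀ (z : E) (η : ℝ), 0 < η → ∫⁻ x in {x | U₂ η (dist x z)},
      ENNReal.ofReal (dist x z ^ (β + θ - s)) ∂m
        ≤ C₂ * ENNReal.ofReal (η ^ (β + θ - s + finrank ℝ E)))
    {κ : ℝ} (hκ0 : 0 < κ) (hκ : κ ≤ 1 / 2) (c : ℝ) :
    ∃ C : ℝ≥0∞, C ≠ ∞ ∧ ∀ ψ : E → ℝ, ContDiff ℝ 1 ψ →
      (∀ x, ψ x ≠ 0 → 0 < infDist x Γ ∧ infDist x Γ ≤ R) →
      (∀ y, fderiv ℝ ψ y ≠ 0 → 0 < infDist y Γ ∧ (K + 1) * infDist y Γ ≤ R) →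
      (∀ x, ψ x ≠ 0 → ∀ ω ∈ Γ, dist x ω ≤ 2 * infDist x Γ →
        ∫⁻ v in ball 0 1, ‖ψ (x + (κ * infDist x Γ) • v)‖ₑ ∂m ≤ ENNReal.ofReal c *
          ∫⁻ y in {y | dist y ω ≤ K * infDist y Γ ∧ 0 < infDist y Γ ∧
              T (infDist x Γ) (infDist y Γ)},
            ‖fderiv ℝ ψ y‖ₑ * ENNReal.ofReal (infDist y Γ ^ (1 - (finrank ℝ E : ℝ))) ∂m) →
      ∫⁻ x, ENNReal.ofReal (infDist x Γ ^ β) * ‖ψ x‖ₑ ^ 2 ∂m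
        ≤ C * ∫⁻ y, ENNReal.ofReal (infDist y Γ ^ (β + 2)) * ‖fderiv ℝ ψ y‖ₑ ^ 2 ∂m := by
  obtain ⟨C₀, hC₀, hP⟩ := exists_lintegral_sq_ball_sub_le m Γ hκ0 hκ β
  set C₃ := ENNReal.ofReal A * (ENNReal.ofReal (K ^ |θ - finrank ℝ E|) * C₁) *
    (ENNReal.ofReal (2 ^ |β + θ - s|) * C₂) * ENNReal.ofReal (A * (K + 1) ^ s) *
      ENNReal.ofReal c ^ 2 with hC₃def
  have hC₃ : C₃ ≠ ∞ := by
    simp only [hC₃def]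
    finiteness
  set V := m (ball (0 : E) 1) with hV
  have hV0 : V ≠ 0 := (measure_ball_pos m 0 one_pos).ne'
  have hVt : V ≠ ∞ := measure_ball_lt_top.ne
  refine ⟨(V ^ 2)⁻¹ * (4 * (C₀ + C₃)), ?_, fun ψ hψ hψR hdψR hkey => ?_⟩
  · have : (V ^ 2)⁻¹ ≠ ∞ := ENNReal.inv_ne_top.2 (pow_ne_zero 2 hV0)
    finiteness
  have hψc := hψ.continuous
  have hdψc := hψ.continuous_fderiv one_ne_zero
  set I := ∫⁻ y, ENNReal.ofReal (infDist y Γ ^ (β + 2)) * ‖fderiv ℝ ψ y‖ₑ ^ 2 ∂m with hI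
  set F : E → ℝ≥0∞ := fun x =>
    if ψ x = 0 then 0 else ∫⁻ v in ball 0 1, ‖ψ (x + (κ * infDist x Γ) • v)‖ₑ ∂m with hF
  set P : E → ℝ≥0∞ := fun x =>
    ∫⁻ v in ball 0 1, ‖ψ x - ψ (x + (κ * infDist x Γ) • v)‖ₑ ∂m with hPdef
  have hFI : ∫⁻ x, ENNReal.ofReal (infDist x Γ ^ β) * F x ^ 2 ∂m ≤ C₃ * I := by
    have hG : Measurable fun y => ENNReal.ofReal c * ‖fderiv ℝ ψ y‖ₑ :=
      (hdψc.enorm.measurable).const_mul _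
    have hF0 : ∀ x, F x ≠ 0 → ψ x ≠ 0 := fun x hx h0 => hx (if_pos h0)
    refine (lintegral_infDist_rpow_mul_sq_le m hΓ hΓne ν hK hA hν hT hU₁ hU₂ h₁ h₂ hG
      (fun y hy => hdψR y fun h0 => hy ?_) (fun x hx => hψR x (hF0 x hx)) (F := F)
      fun x hx ω hω hxω => ?_).trans_eq ?_
    · rw [h0, ← ofReal_norm, norm_zero, ENNReal.ofReal_zero, mul_zero]
    · simp only [hF, if_neg (hF0 x hx), mul_assoc]
      refine (hkey x (hF0 x hx) ω hω hxω).trans_eq (lintegral_const_mul _ ?_).symm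
      exact hdψc.enorm.measurable.mul (measurable_infDist.pow_const _).ennreal_ofReal
    · rw [hI, hC₃def, mul_assoc _ (ENNReal.ofReal c ^ 2),
        ← lintegral_const_mul' (ENNReal.ofReal c ^ 2) _ (by finiteness)]
      simp only [mul_pow, mul_left_comm (ENNReal.ofReal (infDist _ Γ ^ (β + 2)))]
  have hPI : ∫⁻ x, ENNReal.ofReal (infDist x Γ ^ β) * P x ^ 2 ∂m ≤ C₀ * I :=
    hP ψ hψ fun z hz => (hdψR z hz).1
  have hcont : Continuous fun p : E × E => ‖ψ p.1 - ψ (p.1 + (κ * infDist p.1 Γ) • p.2)‖ₑ := by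
    have := continuous_infDist_pt Γ
    fun_prop
  have hPm : Measurable P := hcont.measurable.lintegral_prod_right'
  have hpt : ∀ x, V ^ 2 * ‖ψ x‖ₑ ^ 2 ≤ 4 * (P x ^ 2 + F x ^ 2) := by
    intro x
    have h1 : V * ‖ψ x‖ₑ ≤ P x + F x := by
      by_cases hx : ψ x = 0
      · simp [hx]
      · simp only [hPdef, hF, if_neg hx]
        rw [← lintegral_add_left, mul_comm, hV, ← setLIntegral_const]
        · refine lintegral_mono fun v => ?_
          simpa using enorm_add_le (ψ x - ψ (x + (κ * infDist x Γ) • v))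
            (ψ (x + (κ * infDist x Γ) • v))
        · exact (hcont.comp (Continuous.prodMk_right x)).measurable
    calc V ^ 2 * ‖ψ x‖ₑ ^ 2 = (V * ‖ψ x‖ₑ) ^ 2 := (mul_pow _ _ _).symm
      _ ≤ (2 * max (P x) (F x)) ^ 2 := by
        refine pow_le_pow_left₀ zero_le ?_ 2
        rw [two_mul]
        exact h1.trans (add_le_add (le_max_left _ _) (le_max_right _ _))
      _ = 4 * max (P x) (F x) ^ 2 := by rw [mul_pow]; norm_num
      _ ≤ _ := by
        refine mul_le_mul_right ?_ _
        rcases max_choice (P x) (F x) with h | h <;> rw [h]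
        exacts [le_self_add, le_add_self]
  have hmain : V ^ 2 * ∫⁻ x, ENNReal.ofReal (infDist x Γ ^ β) * ‖ψ x‖ₑ ^ 2 ∂m
      ≤ 4 * (C₀ + C₃) * I := by
    have hDm : Measurable fun x : E => ENNReal.ofReal (infDist x Γ ^ β) :=
      (measurable_infDist.pow_const _).ennreal_ofReal
    rw [← lintegral_const_mul' _ _ (by finiteness)]
    calc _ ≤ ∫⁻ x, 4 * (ENNReal.ofReal (infDist x Γ ^ β) * P x ^ 2 +
            ENNReal.ofReal (infDist x Γ ^ β) * F x ^ 2) ∂m := by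
          refine lintegral_mono fun x => ?_
          rw [mul_left_comm, ← mul_add, mul_left_comm 4]
          exact mul_le_mul_right (hpt x) _
      _ = 4 * (∫⁻ x, ENNReal.ofReal (infDist x Γ ^ β) * P x ^ 2 ∂m +
            ∫⁻ x, ENNReal.ofReal (infDist x Γ ^ β) * F x ^ 2 ∂m) := by
          rw [lintegral_const_mul' _ _ (by finiteness),
            lintegral_add_left (by fun_prop)]
      _ ≤ 4 * (C₀ * I + C₃ * I) := mul_le_mul_right (add_le_add hPI hFI) _
      _ = _ := by ring
  rw [mul_assoc]
  exact (ENNReal.mul_le_iff_le_inv (pow_ne_zero 2 hV0) (ENNReal.pow_ne_top hVt)).1 hmain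

theorem exists_setLIntegral_dist_le_mul_rpow_le [Nontrivial E] {p : ℝ}
    (hp : 0 < p + finrank ℝ E) {L : ℝ} (hL : 0 < L) :
    ∃ C : ℝ≥0∞, C ≠ ∞ ∧ ∀ (z : E) (η : ℝ), 0 < η → ∫⁻ x in {x | dist x z ≤ L * η},
      ENNReal.ofReal (dist x z ^ p) ∂m ≤ C * ENNReal.ofReal (η ^ (p + finrank ℝ E)) := by
  obtain ⟨C, hC, h⟩ := exists_setLIntegral_closedBall_rpow_le m hp
  refine ⟨C * ENNReal.ofReal (L ^ (p + finrank ℝ E)), by finiteness, fun z η hη => ?_⟩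
  rw [mul_assoc, ← ENNReal.ofReal_mul (by positivity), ← Real.mul_rpow hL.le hη.le]
  exact h z _ (by positivity)

theorem exists_setLIntegral_le_mul_dist_rpow_le {p : ℝ} (hp : p + finrank ℝ E < 0) {L : ℝ}
    (hL : 0 < L) :
    ∃ C : ℝ≥0∞, C ≠ ∞ ∧ ∀ (z : E) (η : ℝ), 0 < η → ∫⁻ x in {x | η ≤ L * dist x z},
      ENNReal.ofReal (dist x z ^ p) ∂m ≤ C * ENNReal.ofReal (η ^ (p + finrank ℝ E)) := by
  obtain ⟨C, hC, h⟩ := exists_setLIntegral_compl_ball_rpow_le m hp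
  refine ⟨C * ENNReal.ofReal (L⁻¹ ^ (p + finrank ℝ E)), by finiteness, fun z η hη => ?_⟩
  rw [mul_assoc, ← ENNReal.ofReal_mul (by positivity), ← Real.mul_rpow (by positivity) hη.le]
  simpa only [inv_mul_le_iff₀ hL] using h z (L⁻¹ * η) (by positivity)

theorem exists_lintegral_rpow_infDist_mul_enorm_sq_le_of_ne [Nontrivial E] {Γ : Set E}
    (hΓ : IsClosed Γ) (hΓne : Γ.Nonempty) (ν : Measure E) [SFinite ν] {A s R K β : ℝ}
    (hK : 1 ≤ K) (hA : 0 < A)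
    (hν : ∀ z ∈ Γ, ∀ r, 0 < r → r ≤ R → ENNReal.ofReal (A⁻¹ * r ^ s) ≤ ν (Γ ∩ closedBall z r) ∧
      ν (Γ ∩ closedBall z r) ≤ ENNReal.ofReal (A * r ^ s))
    {T : ℝ → ℝ → Prop} (hT : (T = fun a b => a ≤ K * b) ∧ 0 < β + finrank ℝ E - s ∨
      (T = fun a b => b ≤ K * a) ∧ β + finrank ℝ E - s < 0)
    {κ : ℝ} (hκ0 : 0 < κ) (hκ : κ ≤ 1 / 2) (c : ℝ) :
    ∃ C : ℝ≥0∞, C ≠ ∞ ∧ ∀ ψ : E → ℝ, ContDiff ℝ 1 ψ →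
      (∀ x, ψ x ≠ 0 → 0 < infDist x Γ ∧ infDist x Γ ≤ R) →
      (∀ y, fderiv ℝ ψ y ≠ 0 → 0 < infDist y Γ ∧ (K + 1) * infDist y Γ ≤ R) →
      (∀ x, ψ x ≠ 0 → ∀ ω ∈ Γ, dist x ω ≤ 2 * infDist x Γ →
        ∫⁻ v in ball 0 1, ‖ψ (x + (κ * infDist x Γ) • v)‖ₑ ∂m ≤ ENNReal.ofReal c *
          ∫⁻ y in {y | dist y ω ≤ K * infDist y Γ ∧ 0 < infDist y Γ ∧
              T (infDist x Γ) (infDist y Γ)},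
            ‖fderiv ℝ ψ y‖ₑ * ENNReal.ofReal (infDist y Γ ^ (1 - (finrank ℝ E : ℝ))) ∂m) →
      ∫⁻ x, ENNReal.ofReal (infDist x Γ ^ β) * ‖ψ x‖ₑ ^ 2 ∂m
        ≤ C * ∫⁻ y, ENNReal.ofReal (infDist y Γ ^ (β + 2)) * ‖fderiv ℝ ψ y‖ₑ ^ 2 ∂m := by
  have hK0 : 0 < K := by linarith
  set n : ℝ := (finrank ℝ E : ℝ)
  set θ := -(β + n - s) / 2 with hθ
  have e₁ : θ = θ - n + n := by ring
  rcases hT with ⟨rfl, hp⟩ | ⟨rfl, hp⟩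
  · obtain ⟨C₁, hC₁, h₁⟩ := exists_setLIntegral_le_mul_dist_rpow_le m
      (p := θ - n) (show θ - n + n < 0 by linarith) hK0
    obtain ⟨C₂, hC₂, h₂⟩ := exists_setLIntegral_dist_le_mul_rpow_le m
      (p := β + θ - s) (show 0 < β + θ - s + n by linarith) (L := 2 * K) (by positivity)
    rw [← e₁] at h₁
    refine exists_lintegral_rpow_infDist_mul_enorm_sq_le m hΓ hΓne ν hK hA hν
      (T := fun a b => a ≤ K * b) (U₁ := fun a c => a ≤ K * c)
      (U₂ := fun b c => c ≤ 2 * K * b)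
      (measurableSet_le measurable_fst (measurable_snd.const_mul K))
      (fun a b c _ _ hab hbc _ => ?_) (fun a b c _ _ hab _ hc => ?_) hC₁ hC₂ h₁ h₂ hκ0 hκ c
    · exact hab.trans (by gcongr)
    · linarith
  · obtain ⟨C₁, hC₁, h₁⟩ := exists_setLIntegral_dist_le_mul_rpow_le m
      (p := θ - n) (show 0 < θ - n + n by linarith) (L := K * K) (by positivity)
    obtain ⟨C₂, hC₂, h₂⟩ := exists_setLIntegral_le_mul_dist_rpow_le m
      (p := β + θ - s) (show β + θ - s + n < 0 by linarith) hK0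
    rw [← e₁] at h₁
    refine exists_lintegral_rpow_infDist_mul_enorm_sq_le m hΓ hΓne ν hK hA hν
      (T := fun a b => b ≤ K * a) (U₁ := fun a c => c ≤ K * K * a)
      (U₂ := fun b c => b ≤ K * c)
      (measurableSet_le measurable_snd (measurable_fst.const_mul K))
      (fun a b c _ _ hab _ hc => ?_) (fun a b c _ _ hab hac _ => ?_) hC₁ hC₂ h₁ h₂ hκ0 hκ c
    · rw [mul_assoc]
      exact hc.trans (by gcongr)
    · exact hab.trans (by gcongr)

theorem exists_bHardy_of_lintegral_le {d : ℕ} {Ω S : Set (EuclideanSpace ℝ (Fin d))} {δ : ℝ}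
    {C : ℝ≥0∞} (hC : C ≠ ∞) (h : ∀ ψ, IsCc1 S ψ →
      ∫⁻ x, ENNReal.ofReal (infDist x (frontier Ω) ^ (δ - 2)) * ‖ψ x‖ₑ ^ 2
        ≤ C * ∫⁻ y, ENNReal.ofReal (infDist y (frontier Ω) ^ (δ - 2 + 2)) * ‖fderiv ℝ ψ y‖ₑ ^ 2) :
    ∃ a > (0 : ℝ), BHardy Ω δ S a := by
  refine ⟨√C.toReal + 1, by positivity, fun ψ hψ => ?_⟩
  have hN : ∀ (p : ℝ) (f : EuclideanSpace ℝ (Fin d) → ℝ),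
      L2N (fun x => distB Ω x ^ p * f x) =
        (∫⁻ x, ENNReal.ofReal (infDist x (frontier Ω) ^ (p * 2)) * ‖f x‖ₑ ^ 2) ^ (1 / 2 : ℝ) := by
    intro p f
    rw [L2N, eLpNorm_eq_lintegral_rpow_enorm_toReal two_ne_zero ENNReal.ofNat_ne_top]
    simp only [ENNReal.toReal_ofNat, ENNReal.rpow_two, enorm_mul, mul_pow, distB]
    congr! 4 with x
    have h0 : 0 ≤ infDist x (frontier Ω) := infDist_nonneg
    rw [Real.enorm_of_nonneg (by positivity), ← ENNReal.ofReal_pow (by positivity),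
      ← Real.rpow_mul_natCast h0, Nat.cast_ofNat]
  rw [wNorm, wGradNorm, hN, hN, show (δ / 2 - 1) * 2 = δ - 2 by ring,
    show δ / 2 * 2 = δ - 2 + 2 by ring]
  simp only [enorm_norm]
  refine (ENNReal.rpow_le_rpow (h ψ hψ) (by norm_num)).trans ?_
  rw [ENNReal.mul_rpow_of_nonneg _ _ (by norm_num)]
  gcongr
  rw [← ENNReal.ofReal_toReal hC, ENNReal.ofReal_rpow_of_nonneg ENNReal.toReal_nonneg (by norm_num),
    ← Real.sqrt_eq_rpow, ENNReal.toReal_ofReal ENNReal.toReal_nonneg]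
  exact ENNReal.ofReal_le_ofReal (by linarith)

theorem LocUnifAhlfors.exists_measure {d : ℕ} {Ω : Set (EuclideanSpace ℝ (Fin d))} {s : ℝ}
    (h : LocUnifAhlfors Ω s) :
    ∃ (μ : Measure (EuclideanSpace ℝ (Fin d))) (A R : ℝ), SFinite μ ∧ 0 < A ∧ 0 < R ∧
      ∀ z ∈ frontier Ω, ∀ r, 0 < r → r ≤ R →
        ENNReal.ofReal (A⁻¹ * r ^ s) ≤ μ (frontier Ω ∩ closedBall z r) ∧
          μ (frontier Ω ∩ closedBall z r) ≤ ENNReal.ofReal (A * r ^ s) := by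
  obtain ⟨μ, A, R, hA, hR, hμ, hμA⟩ := h
  have hb : ∀ z ∈ frontier Ω, ∀ r, 0 < r → r ≤ R →
      ENNReal.ofReal (A⁻¹ * r ^ s) ≤ μ (frontier Ω ∩ closedBall z r) ∧
        μ (frontier Ω ∩ closedBall z r) ≤ ENNReal.ofReal (A * r ^ s) := by
    intro z hz r hr hrR
    have := hμA z hz z ⟨hz, mem_closedBall_self hR.le⟩ r ⟨hr, by linarith⟩
    rwa [inter_assoc, inter_eq_self_of_subset_right (closedBall_subset_closedBall hrR)] at this
  have hfin : IsLocallyFiniteMeasure μ := by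
    refine ⟨fun x => ?_⟩
    by_cases hx : x ∈ frontier Ω
    · refine ⟨closedBall x R, closedBall_mem_nhds x hR, ?_⟩
      refine (measure_mono (t := frontier Ω ∩ closedBall x R ∪ (frontier Ω)ᶜ) fun y hy => ?_).trans_lt
        ((measure_union_le _ _).trans_lt ?_)
      · by_cases hy' : y ∈ frontier Ω
        exacts [Or.inl ⟨hy', hy⟩, Or.inr hy']
      · rw [hμ, add_zero]
        exact (hb x hx R hR le_rfl).2.trans_lt ENNReal.ofReal_lt_top
    · exact ⟨_, isClosed_frontier.isOpen_compl.mem_nhds hx, by rw [hμ]; exact zero_lt_top⟩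
  exact ⟨μ, A, R, inferInstance, by linarith, hR, hb⟩

theorem UniformDomain.exists_lipschitzWith {d : ℕ} {Ω : Set (EuclideanSpace ℝ (Fin d))}
    (h : UniformDomain Ω) :
    ∃ σ : ℝ, 1 ≤ σ ∧ ∀ x ∈ Ω, ∀ y ∈ Ω, ∃ (l : ℝ) (γ : ℝ → EuclideanSpace ℝ (Fin d)),
      0 ≤ l ∧ l ≤ σ * dist x y ∧ dist x y ≤ l ∧ LipschitzWith 1 γ ∧ γ 0 = x ∧ γ l = y ∧
        ∀ t ∈ Icc 0 l, σ⁻¹ * min t (l - t) ≤ infDist (γ t) (frontier Ω) := by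
  obtain ⟨σ, hσ, hγ⟩ := h
  refine ⟨σ, hσ, fun x hx y hy => ?_⟩
  obtain ⟨l, hl0, hl, γ, h0, h1, hγL, hγD⟩ := hγ x hx y hy
  obtain ⟨c, hc, hcγ⟩ := hγL.exists_lipschitzWith_eqOn_Icc hl0
  have hc0 : c 0 = x := (hcγ ⟨le_rfl, hl0⟩).trans h0
  have hcl : c l = y := (hcγ ⟨hl0, le_rfl⟩).trans h1
  refine ⟨l, c, hl0, hl, ?_, hc, hc0, hcl, fun t ht => ?_⟩
  · have := hc.dist_le_mul 0 l
    rwa [hc0, hcl, NNReal.coe_one, one_mul, dist_comm 0 l, Real.dist_eq, sub_zero,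
      abs_of_nonneg hl0] at this
  · rw [hcγ ht]
    exact (hγD t ht).2

end Hardy

/-- If `Ω` is a uniform domain whose boundary is locally uniformly Ahlfors
`d_H`-regular, `d_H` being the Hausdorff dimension of `Γ`, and `δ ≥ 0` satisfies either
`δ < 2-(d-d_H)` or `δ > 2-(d-d_H)`, then there is `r₀ > 0` such that for each
`r ∈ (0,r₀)` the boundary Hardy inequality holds on `Γ_r` with some constant `a > 0`. -/
theorem stmt5 {d : ℕ} (hd : 1 ≤ d) (Ω : Set (EuclideanSpace ℝ (Fin d)))
    (hΩ : IsDomainSet Ω) (hunif : UniformDomain Ω)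
    (dH : ℝ) (hdH : dimH (frontier Ω) = ENNReal.ofReal dH) (hdH0 : 0 ≤ dH)
    (hA : LocUnifAhlfors Ω dH)
    (δ : ℝ) (hδ0 : 0 ≤ δ)
    (hδ : δ < 2 - ((d : ℝ) - dH) ∨ 2 - ((d : ℝ) - dH) < δ) :
    ∃ r₀ > (0:ℝ), ∀ r ∈ Set.Ioo (0:ℝ) r₀, ∃ a > (0:ℝ), BHardy Ω δ (bdryLayer Ω r) a := by
  have : Nonempty (Fin d) := ⟨⟨0, hd⟩⟩
  obtain ⟨hΩo, hΩc, hΩu⟩ := hΩ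
  obtain ⟨μ, A, R, hμ, hA0, hR, hμA⟩ := hA.exists_measure
  obtain ⟨σ, hσ, hγ⟩ := hunif.exists_lipschitzWith
  have hσ0 : 0 < σ := by linarith
  have hΓ : IsClosed (frontier Ω) := isClosed_frontier
  have hΓne : (frontier Ω).Nonempty := nonempty_frontier_iff.2 ⟨hΩc.nonempty, hΩu⟩
  have hDpos : ∀ x ∈ Ω, 0 < infDist x (frontier Ω) := fun x hx =>
    (hΓ.notMem_iff_infDist_pos hΓne).1 fun hxΓ => hΩo.inter_frontier_eq.subset ⟨hx, hxΓ⟩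
  obtain ⟨p, hp⟩ := hΩc.nonempty
  obtain ⟨q, hq, hpq⟩ := (infinite_of_mem_nhds p (hΩo.mem_nhds hp)).nontrivial.exists_ne p
  have hpq' : 0 < dist p q := dist_pos.2 hpq.symm
  set K := 50 * σ ^ 2 with hK
  have hK1 : 1 ≤ K := by nlinarith
  have hκ0 : 0 < (6 * σ)⁻¹ := by positivity
  have hκ1 : (6 * σ)⁻¹ ≤ 1 / 2 := by
    rw [one_div]; exact inv_anti₀ (by norm_num) (by linarith)
  have hfin : (Module.finrank ℝ (EuclideanSpace ℝ (Fin d)) : ℝ) = d := by simp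
  refine ⟨min (R / (K + 1)) (dist p q / (24 * σ)), by positivity, fun r hr => ?_⟩
  have hrR : (K + 1) * r ≤ R := by
    rw [mul_comm, ← le_div_iff₀ (by positivity)]
    exact hr.2.le.trans (min_le_left _ _)
  have hrpq : 24 * σ * r ≤ dist p q := by
    rw [mul_comm, ← le_div_iff₀ (by positivity)]
    exact hr.2.le.trans (min_le_right _ _)
  have hsupp : ∀ ψ, IsCc1 (bdryLayer Ω r) ψ → ∀ x ∈ tsupport ψ,
      x ∈ Ω ∧ 0 < infDist x (frontier Ω) ∧ infDist x (frontier Ω) < r := fun ψ hψ x hx =>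
    ⟨(hψ.2.2 hx).1, hDpos x (hψ.2.2 hx).1, (hψ.2.2 hx).2⟩
  have hreg : ∀ ψ, IsCc1 (bdryLayer Ω r) ψ → ∀ x ∈ tsupport ψ,
      0 < infDist x (frontier Ω) ∧ (K + 1) * infDist x (frontier Ω) ≤ R := fun ψ hψ x hx =>
    ⟨(hsupp ψ hψ x hx).2.1, le_trans (by have := (hsupp ψ hψ x hx).2.2.le; gcongr) hrR⟩
  have hmem : ∀ (ψ : EuclideanSpace ℝ (Fin d) → ℝ) x, ψ x ≠ 0 → x ∈ tsupport ψ :=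
    fun ψ x hx => subset_tsupport ψ hx
  have hdmem : ∀ (ψ : EuclideanSpace ℝ (Fin d) → ℝ) x, fderiv ℝ ψ x ≠ 0 → x ∈ tsupport ψ :=
    fun ψ x hx => support_fderiv_subset ℝ hx
  rcases hδ with hδ | hδ
  · obtain ⟨C, hC, hmain⟩ := exists_lintegral_rpow_infDist_mul_enorm_sq_le_of_ne volume hΓ hΓne μ
      hK1 hA0 hμA (β := δ - 2) (Or.inr ⟨rfl, by rw [hfin]; linarith⟩) hκ0 hκ1
      (2 * K ^ ((Module.finrank ℝ (EuclideanSpace ℝ (Fin d)) : ℝ) + 1))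
    refine exists_bHardy_of_lintegral_le hC fun ψ hψ => hmain ψ hψ.1 (fun x hx => ?_)
      (fun x hx => hreg ψ hψ x (hdmem ψ x hx)) fun x hx ω hω hxω => ?_
    · obtain ⟨h1, h2⟩ := hreg ψ hψ x (hmem ψ x hx)
      exact ⟨h1, by nlinarith⟩
    obtain ⟨ε, hε, hεψ⟩ := IsCompact.exists_forall_le' hψ.2.1
      (Metric.continuous_infDist_pt (frontier Ω)).continuousOn
      fun x hx => (hsupp ψ hψ x hx).2.1
    obtain ⟨hxΩ, hx0, -⟩ := hsupp ψ hψ x (hmem ψ x hx)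
    obtain ⟨x', hx'Ω, hx'⟩ := Metric.mem_closure_iff.1 (frontier_subset_closure hω)
      (min (ε / 2) (infDist x (frontier Ω) / 2)) (by positivity)
    rw [dist_comm, lt_min_iff] at hx'
    obtain ⟨l, γ, hl0, hl, -, hγL, rfl, rfl, hγD⟩ := hγ x' hx'Ω x hxΩ
    exact lintegral_ball_enorm_le_of_near volume hσ hψ.1 (fun y hy => hεψ y (hmem ψ y hy))
      (fun y hy => hεψ y (hdmem ψ y hy)) hγL hl0 hl hγD hx0 (hDpos _ hx'Ω) hω hxω hx'.1 hx'.2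
  · obtain ⟨C, hC, hmain⟩ := exists_lintegral_rpow_infDist_mul_enorm_sq_le_of_ne volume hΓ hΓne μ
      hK1 hA0 hμA (β := δ - 2) (Or.inl ⟨rfl, by rw [hfin]; linarith⟩) hκ0 hκ1
      (2 * K ^ ((Module.finrank ℝ (EuclideanSpace ℝ (Fin d)) : ℝ) + 1))
    refine exists_bHardy_of_lintegral_le hC fun ψ hψ => hmain ψ hψ.1 (fun x hx => ?_)
      (fun x hx => hreg ψ hψ x (hdmem ψ x hx)) fun x hx ω hω hxω => ?_
    · obtain ⟨h1, h2⟩ := hreg ψ hψ x (hmem ψ x hx)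
      exact ⟨h1, by nlinarith⟩
    obtain ⟨hxΩ, hx0, hxr⟩ := hsupp ψ hψ x (hmem ψ x hx)
    obtain ⟨z, hzΩ, hz⟩ : ∃ z ∈ Ω, 12 * σ * r ≤ dist x z := by
      have := dist_triangle_left p q x
      rcases le_or_gt (12 * σ * r) (dist x p) with h | h
      exacts [⟨p, hp, h⟩, ⟨q, hq, by linarith⟩]
    obtain ⟨l, γ, hl0, -, hl, hγL, rfl, rfl, hγD⟩ := hγ x hxΩ z hzΩ
    exact lintegral_ball_enorm_le_of_far volume hσ hψ.1
      (fun y hy => (hsupp ψ hψ y (hmem ψ y hy)).2.2) hγL (hz.trans hl) hγD hx0 hxr hxω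
end
end
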